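/- arXiv:2602.08330 — 2 statements merged into one kernel-verified Lean document; each statement's English description precedes it below -/
import Mathlib

section
/- Let $\bar{M}^n$, $n \geq 3$, be an $n$-dimensional submanifold of an $m$-dimensional, $m \geq 4$, generalized Robertson–Walker spacetime $\widetilde{M}^m = I \times_f M^{m-1}(c)$ with metric $\widetilde{g} = dt^2 + f^2 g$, where $f$ is a nowhere-vanishing smooth function. If $\frac{\partial}{\partial t}$ is everywhere tangent to $\bar{M}^n$, then $\rho + \rho^{\perp} \leq \Vert H \Vert^2 + \frac{c - (f')^2}{f^2}\left(1 - \frac{2}{n}\right) - \frac{2}{n}\frac{f''}{f}$, and if $\frac{\partial}{\partial t}$ is everywhere normal to $\bar{M}^n$, then $\rho + \rho^{\perp} \leq \Vert H \Vert^2 + \frac{c - (f')^2}{f^2}$. -/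
open Finset Matrix

/-- Kronecker delta (the components of the metric in an orthonormal frame). -/
noncomputable def kdelta {k : ℕ} (a b : Fin k) : ℝ := if a = b then 1 else 0

/-- The scalar curvature `tau = sum_{i<j} R(e_i, e_j, e_j, e_i)` computed from the
components of the curvature tensor in an orthonormal frame. -/
noncomputable def scalarCurv {n : ℕ} (R : Fin n → Fin n → Fin n → Fin n → ℝ) : ℝ :=
  ∑ i : Fin n, ∑ j : Fin n, if i < j then R i j j i else 0

/-- The normalized scalar curvature `rho = 2 tau / (n (n - 1))`. -/
noncomputable def normScalarCurv {n : ℕ} (R : Fin n → Fin n → Fin n → Fin n → ℝ) : ℝ :=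
  2 * scalarCurv R / ((n : ℝ) * ((n : ℝ) - 1))

/-- The normal scalar curvature `K_N = -(1/4) sum_{r,s} trace ([A_r, A_s]^2)` computed from
the shape operators (given as symmetric matrices in an orthonormal tangent frame). -/
noncomputable def KN {n p : ℕ} (A : Fin p → Matrix (Fin n) (Fin n) ℝ) : ℝ :=
  -(1 / 4) * ∑ r : Fin p, ∑ s : Fin p,
    Matrix.trace ((A r * A s - A s * A r) * (A r * A s - A s * A r))

/-- The normalized normal scalar curvature `rho_N = (2/(n(n-1))) sqrt(K_N)`. -/
noncomputable def rhoN {n p : ℕ} (A : Fin p → Matrix (Fin n) (Fin n) ℝ) : ℝ :=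
  2 / ((n : ℝ) * ((n : ℝ) - 1)) * Real.sqrt (KN A)

/-- The squared mean curvature `|H|^2 = sum_r ((1/n) trace A_r)^2` computed from the
components of the second fundamental form in adapted orthonormal frames. -/
noncomputable def meanCurvSq {n p : ℕ} (A : Fin p → Matrix (Fin n) (Fin n) ℝ) : ℝ :=
  ∑ r : Fin p, ((1 / (n : ℝ)) * ∑ i : Fin n, A r i i) ^ 2

/-- The normalized normal scalar curvature
`rho^perp = (2/(n(n-1))) sqrt( sum_{i<j} sum_{r<s} (Rperp(e_i,e_j,v_r,v_s))^2 )`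
computed from the components of the normal curvature tensor. -/
noncomputable def rhoPerp {n p : ℕ} (Rp : Fin n → Fin n → Fin p → Fin p → ℝ) : ℝ :=
  2 / ((n : ℝ) * ((n : ℝ) - 1)) *
    Real.sqrt (∑ i : Fin n, ∑ j : Fin n, ∑ r : Fin p, ∑ s : Fin p,
      if i < j ∧ r < s then Rp i j r s ^ 2 else 0)

/-- The Ricci curvature `Ric(e_b, e_c) = sum_a R(e_a, e_b, e_c, e_a)` computed from the
components of the curvature tensor in an orthonormal frame. -/
noncomputable def ambRicci {m : ℕ} (Rt : Fin m → Fin m → Fin m → Fin m → ℝ)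
    (b c : Fin m) : ℝ :=
  ∑ a : Fin m, Rt a b c a

/-- The (ambient) scalar curvature `tau = sum_{a<b} sigma(e_a, e_b) = (1/2) sum_a Ric(e_a,e_a)`. -/
noncomputable def ambScalar {m : ℕ} (Rt : Fin m → Fin m → Fin m → Fin m → ℝ) : ℝ :=
  (1 / 2) * ∑ a : Fin m, ambRicci Rt a a

/-- The Frobenius inner product of two real square matrices. -/
def frobInner {n : ℕ} (X Y : Matrix (Fin n) (Fin n) ℝ) : ℝ :=
  ∑ i, ∑ j, X i j * Y i j

theorem frobInner_eq_trace {n : ℕ} (X Y : Matrix (Fin n) (Fin n) ℝ) :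
    frobInner X Y = (Xᵀ * Y).trace := by
  simp only [frobInner, Matrix.trace, Matrix.diag_apply, Matrix.mul_apply, Matrix.transpose_apply]
  exact Finset.sum_comm

theorem frobInner_self_nonneg {n : ℕ} (X : Matrix (Fin n) (Fin n) ℝ) : 0 ≤ frobInner X X :=
  Finset.sum_nonneg fun i _ => Finset.sum_nonneg fun j _ => mul_self_nonneg (X i j)

theorem frobInner_comm {n : ℕ} (X Y : Matrix (Fin n) (Fin n) ℝ) :
    frobInner X Y = frobInner Y X := by
  simp only [frobInner, mul_comm]

theorem frobInner_smul_smul {n : ℕ} (a b : ℝ) (X Y : Matrix (Fin n) (Fin n) ℝ) :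
    frobInner (a • X) (b • Y) = a * b * frobInner X Y := by
  simp only [frobInner, Matrix.smul_apply, smul_eq_mul, Finset.mul_sum]
  exact Finset.sum_congr rfl fun i _ => Finset.sum_congr rfl fun j _ => by ring

theorem eq_zero_of_frobInner_self {n : ℕ} {X : Matrix (Fin n) (Fin n) ℝ}
    (hX : frobInner X X = 0) : X = 0 := by
  ext i j
  have h1 := (Finset.sum_eq_zero_iff_of_nonneg fun i _ =>
    Finset.sum_nonneg fun j _ => mul_self_nonneg (X i j)).1 hX i (Finset.mem_univ i)
  have h2 := (Finset.sum_eq_zero_iff_of_nonneg fun j _ => mul_self_nonneg (X i j)).1 h1 j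
    (Finset.mem_univ j)
  simpa using h2

theorem frobInner_conj {n : ℕ} {U : Matrix (Fin n) (Fin n) ℝ} (hU : U * Uᵀ = 1)
    (X Y : Matrix (Fin n) (Fin n) ℝ) :
    frobInner (Uᵀ * X * U) (Uᵀ * Y * U) = frobInner X Y := by
  rw [frobInner_eq_trace, frobInner_eq_trace]
  have h1 : (Uᵀ * X * U)ᵀ * (Uᵀ * Y * U) = Uᵀ * (Xᵀ * (U * Uᵀ) * Y * U) := by
    simp only [Matrix.transpose_mul, Matrix.transpose_transpose, Matrix.mul_assoc]
  rw [h1, hU, Matrix.trace_mul_comm, Matrix.mul_assoc, hU]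
  simp

theorem exists_orthogonal_diagonalization {n : ℕ} {A : Matrix (Fin n) (Fin n) ℝ}
    (hA : A.IsSymm) :
    ∃ (U : Matrix (Fin n) (Fin n) ℝ) (l : Fin n → ℝ),
      U * Uᵀ = 1 ∧ Uᵀ * U = 1 ∧ Uᵀ * A * U = Matrix.diagonal l := by
  have hH : A.IsHermitian := by
    rwa [Matrix.IsHermitian, Matrix.conjTranspose_eq_transpose_of_trivial]
  have h1 : (hH.eigenvectorUnitary : Matrix (Fin n) (Fin n) ℝ) *
      (hH.eigenvectorUnitary : Matrix (Fin n) (Fin n) ℝ)ᵀ = 1 := by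
    have := Unitary.coe_mul_star_self hH.eigenvectorUnitary
    rwa [Unitary.coe_star, Matrix.star_eq_conjTranspose, Matrix.conjTranspose_eq_transpose_of_trivial] at this
  have h2 := mul_eq_one_comm.1 h1
  refine ⟨hH.eigenvectorUnitary, hH.eigenvalues, h1, h2, ?_⟩
  have h3 := hH.spectral_theorem
  rw [Unitary.conjStarAlgAut_apply, Matrix.star_eq_conjTranspose,
    Matrix.conjTranspose_eq_transpose_of_trivial] at h3
  generalize (hH.eigenvectorUnitary : Matrix (Fin n) (Fin n) ℝ) = U at *
  have h4 : Matrix.diagonal ((RCLike.ofReal : ℝ → ℝ) ∘ hH.eigenvalues)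
      = Matrix.diagonal hH.eigenvalues := rfl
  rw [h4] at h3
  conv_lhs => rw [h3]
  calc Uᵀ * (U * Matrix.diagonal hH.eigenvalues * Uᵀ) * U
      = (Uᵀ * U) * Matrix.diagonal hH.eigenvalues * (Uᵀ * U) := by
        simp only [Matrix.mul_assoc]
    _ = _ := by rw [h2]; simp

/-- Bessel's inequality for an orthogonal family of vectors of length at most one. -/
theorem sum_sq_frobInner_le {n : ℕ} {ι : Type*} [Fintype ι]
    (B : ι → Matrix (Fin n) (Fin n) ℝ)
    (horth : ∀ a b, a ≠ b → frobInner (B a) (B b) = 0)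
    (hle : ∀ a, frobInner (B a) (B a) ≤ 1) (V : Matrix (Fin n) (Fin n) ℝ) :
    ∑ a, frobInner (B a) V ^ 2 ≤ frobInner V V := by
  classical
  have hlin : ∀ (x : ι → ℝ) (Y : Matrix (Fin n) (Fin n) ℝ),
      frobInner (∑ a, x a • B a) Y = ∑ a, x a * frobInner (B a) Y := by
    intro x Y
    simp only [frobInner_eq_trace, Matrix.transpose_sum, Matrix.transpose_smul, Finset.sum_mul,
      Matrix.trace_sum, Matrix.smul_mul, Matrix.trace_smul, smul_eq_mul]
  set S := ∑ a, frobInner (B a) V • B a with hS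
  have h1 : frobInner S V = ∑ a, frobInner (B a) V ^ 2 := by
    rw [hS, hlin]; simp only [pow_two]
  have h2 : frobInner S S ≤ ∑ a, frobInner (B a) V ^ 2 := by
    conv_lhs => rw [hS, hlin]
    refine Finset.sum_le_sum fun a _ => ?_
    have h3 : frobInner (B a) S = frobInner (B a) V * frobInner (B a) (B a) := by
      rw [frobInner_comm, hS, hlin, Finset.sum_eq_single a]
      · intro b _ hb
        rw [horth b a hb, mul_zero]
      · simp
    rw [h3]
    nlinarith [mul_nonneg (sq_nonneg (frobInner (B a) V)) (sub_nonneg.2 (hle a))]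
  have h4 : frobInner (V - S) (V - S) = frobInner V V - 2 * frobInner S V + frobInner S S := by
    simp only [frobInner, Matrix.sub_apply, Finset.mul_sum, ← Finset.sum_sub_distrib,
      ← Finset.sum_add_distrib]
    exact Finset.sum_congr rfl fun i _ => Finset.sum_congr rfl fun j _ => by ring
  have h5 := frobInner_self_nonneg (V - S)
  linarith

theorem sum_sq_entry_le_half {n : ℕ} {ι : Type*} [Fintype ι]
    (B : ι → Matrix (Fin n) (Fin n) ℝ) (hsymm : ∀ a, (B a).IsSymm)
    (horth : ∀ a b, a ≠ b → frobInner (B a) (B b) = 0)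
    (hle : ∀ a, frobInner (B a) (B a) ≤ 1) {i j : Fin n} (hij : i ≠ j) :
    ∑ a, B a i j ^ 2 ≤ 1 / 2 := by
  have hval : ∀ X : Matrix (Fin n) (Fin n) ℝ,
      frobInner X (Matrix.single i j (1 / 2) + Matrix.single j i (1 / 2))
        = (X i j + X j i) / 2 := by
    intro X
    simp only [frobInner, Matrix.add_apply, mul_add, Finset.sum_add_distrib, Matrix.single_apply,
      ite_and, mul_ite, mul_zero, Finset.sum_ite_eq, Finset.mem_univ, if_true,
      Finset.sum_ite_irrel, Finset.sum_const_zero]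
    ring
  have h1 := sum_sq_frobInner_le B horth hle
    (Matrix.single i j (1 / 2) + Matrix.single j i (1 / 2))
  simp only [hval] at h1
  have h2 : ∀ a, (B a i j + B a j i) / 2 = B a i j := fun a => by
    rw [(hsymm a).apply i j]; ring
  simp only [h2] at h1
  refine h1.trans (le_of_eq ?_)
  simp [hij, hij.symm]

/-- If `∑ lₖ² ≤ 1`, all pairs of entries at distance more than one share a common index. -/
theorem exists_center {n : ℕ} (l : Fin n → ℝ) (hl : ∑ i, l i ^ 2 ≤ 1) (i₀ : Fin n) :
    ∃ c, ∀ i j, 1 < (l i - l j) ^ 2 → i = c ∨ j = c := by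
  have hsub : ∀ s : Finset (Fin n), ∑ i ∈ s, l i ^ 2 ≤ 1 := fun s =>
    (Finset.sum_le_sum_of_subset_of_nonneg (Finset.subset_univ s)
      fun i _ _ => sq_nonneg (l i)).trans hl
  have hne : ∀ {i j}, 1 < (l i - l j) ^ 2 → i ≠ j := by
    rintro i j h rfl
    norm_num at h
  have hdisj : ∀ i j p q, 1 < (l i - l j) ^ 2 → 1 < (l p - l q) ^ 2 →
      p = i ∨ p = j ∨ q = i ∨ q = j := by
    intro i j p q h1 h2
    by_contra! hcon
    obtain ⟨a, b, c, d⟩ := hcon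
    have h3 := hsub {i, j, p, q}
    rw [Finset.sum_insert, Finset.sum_insert, Finset.sum_insert, Finset.sum_singleton] at h3
    · nlinarith [sq_nonneg (l i + l j), sq_nonneg (l p + l q)]
    · simpa using hne h2
    · simp [b.symm, d.symm]
    · simp [a.symm, c.symm, hne h1]
  have htri : ∀ i j k, 1 < (l i - l j) ^ 2 → 1 < (l j - l k) ^ 2 → 1 < (l i - l k) ^ 2 →
      False := by
    intro i j k h1 h2 h3
    have h4 := hsub {i, j, k}
    rw [Finset.sum_insert, Finset.sum_insert, Finset.sum_singleton] at h4
    · nlinarith [sq_nonneg (l i + l j + l k)]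
    · simpa using hne h2
    · simp [hne h1, hne h3]
  have hcomm : ∀ i j, 1 < (l i - l j) ^ 2 → 1 < (l j - l i) ^ 2 := fun i j h => by
    nlinarith
  by_contra! hcon
  obtain ⟨i, j, hij, -, -⟩ := hcon i₀
  obtain ⟨p, q, hpq, hpi, hqi⟩ := hcon i
  obtain ⟨u, v, huv, huj, hvj⟩ := hcon j
  have key : ∀ k, 1 < (l j - l k) ^ 2 → k ≠ i → False := by
    intro k hjk hki
    have e1 := hdisj i j u v hij huv
    have e2 := hdisj j k u v hjk huv
    have huv_ne := hne huv
    have e : u = i ∧ v = k ∨ u = k ∧ v = i := by grind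
    rcases e with ⟨rfl, rfl⟩ | ⟨rfl, rfl⟩
    · exact htri _ _ _ hij hjk huv
    · exact htri _ _ _ hij hjk (hcomm _ _ huv)
  rcases hdisj i j p q hij hpq with rfl | rfl | rfl | rfl
  · exact hpi rfl
  · exact key q hpq hqi
  · exact hqi rfl
  · exact key p (hcomm _ _ hpq) hpi

theorem sum_star_le {n : ℕ} (l : Fin n → ℝ) (hl : ∑ i, l i ^ 2 ≤ 1) (c : Fin n) :
    ∑ j, max 0 ((l c - l j) ^ 2 - 1) ≤ 1 := by
  classical
  set s := Finset.univ.filter fun j => 1 < (l c - l j) ^ 2 with hs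
  have hcs : c ∉ s := by simp [hs]
  have h1 : ∑ j, max 0 ((l c - l j) ^ 2 - 1) = ∑ j ∈ s, ((l c - l j) ^ 2 - 1) := by
    rw [hs, Finset.sum_filter]
    refine Finset.sum_congr rfl fun j _ => ?_
    split_ifs with h
    · exact max_eq_right (by linarith)
    · exact max_eq_left (by linarith)
  have h2 : l c ^ 2 + ∑ j ∈ s, l j ^ 2 ≤ 1 := by
    rw [← Finset.sum_insert (f := fun j => l j ^ 2) hcs]
    exact (Finset.sum_le_sum_of_subset_of_nonneg (Finset.subset_univ _)
      fun i _ _ => sq_nonneg (l i)).trans hl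
  have h3 : (∑ j ∈ s, l j) ^ 2 ≤ #s * ∑ j ∈ s, l j ^ 2 := sq_sum_le_card_mul_sum_sq
  have h4 : ∑ j ∈ s, ((l c - l j) ^ 2 - 1)
      = #s * l c ^ 2 - 2 * l c * (∑ j ∈ s, l j) + (∑ j ∈ s, l j ^ 2) - #s := by
    simp only [sub_sq, Finset.sum_sub_distrib, Finset.sum_add_distrib, Finset.sum_const,
      nsmul_eq_mul, Finset.mul_sum, mul_one]
  rw [h1, h4]
  nlinarith [sq_nonneg (l c + ∑ j ∈ s, l j),
    mul_nonneg (Nat.cast_nonneg (α := ℝ) #s) (sub_nonneg.2 h2)]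

theorem sum_excess_le_two {n : ℕ} (l : Fin n → ℝ) (hl : ∑ i, l i ^ 2 ≤ 1) :
    ∑ i, ∑ j, max 0 ((l i - l j) ^ 2 - 1) ≤ 2 := by
  rcases isEmpty_or_nonempty (Fin n) with hE | ⟨⟨i₀⟩⟩
  · simp
  obtain ⟨c, hc⟩ := exists_center l hl i₀
  have hterm : ∀ i j, max 0 ((l i - l j) ^ 2 - 1) ≤
      (if i = c then max 0 ((l c - l j) ^ 2 - 1) else 0) +
      (if j = c then max 0 ((l c - l i) ^ 2 - 1) else 0) := by
    intro i j
    have n1 : 0 ≤ (if i = c then max 0 ((l c - l j) ^ 2 - 1) else 0) := by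
      split_ifs <;> simp
    have n2 : 0 ≤ (if j = c then max 0 ((l c - l i) ^ 2 - 1) else 0) := by
      split_ifs <;> simp
    by_cases h : 1 < (l i - l j) ^ 2
    · rcases hc i j h with rfl | rfl
      · rw [if_pos rfl]
        linarith
      · rw [if_pos rfl, sub_sq_comm (l i) (l j)]
        linarith
    · rw [max_eq_left (by linarith)]
      linarith
  calc ∑ i, ∑ j, max 0 ((l i - l j) ^ 2 - 1)
      ≤ ∑ i, ∑ j, ((if i = c then max 0 ((l c - l j) ^ 2 - 1) else 0) +
          (if j = c then max 0 ((l c - l i) ^ 2 - 1) else 0)) :=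
        Finset.sum_le_sum fun i _ => Finset.sum_le_sum fun j _ => hterm i j
    _ = ∑ j, max 0 ((l c - l j) ^ 2 - 1) + ∑ j, max 0 ((l c - l j) ^ 2 - 1) := by
        simp [Finset.sum_add_distrib, Finset.sum_ite_irrel]
    _ ≤ 2 := by linarith [sum_star_le l hl c]

theorem sum_commutator_excess_le_one {n : ℕ} {ι : Type*} [Fintype ι]
    (A : Matrix (Fin n) (Fin n) ℝ) (hA : A.IsSymm) (hA1 : frobInner A A ≤ 1)
    (B : ι → Matrix (Fin n) (Fin n) ℝ) (hsymm : ∀ a, (B a).IsSymm)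
    (horth : ∀ a b, a ≠ b → frobInner (B a) (B b) = 0)
    (hle : ∀ a, frobInner (B a) (B a) ≤ 1) :
    ∑ a, max 0 (frobInner (A * B a - B a * A) (A * B a - B a * A) - 1) ≤ 1 := by
  obtain ⟨U, l, hU, -, hD⟩ := exists_orthogonal_diagonalization hA
  have hl : ∑ i, l i ^ 2 ≤ 1 := by
    rw [← frobInner_conj hU, hD] at hA1
    simpa [frobInner, Matrix.diagonal_apply, pow_two] using hA1
  set C := fun a => Uᵀ * B a * U with hC
  have hCsymm : ∀ a, (C a).IsSymm := fun a => by
    simp only [hC, Matrix.IsSymm, Matrix.transpose_mul, Matrix.transpose_transpose,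
      (hsymm a).eq, Matrix.mul_assoc]
  have hCorth : ∀ a b, a ≠ b → frobInner (C a) (C b) = 0 := fun a b hab => by
    rw [frobInner_conj hU, horth a b hab]
  have hCle : ∀ a, frobInner (C a) (C a) ≤ 1 := fun a => by
    rw [frobInner_conj hU]
    exact hle a
  have hcomm : ∀ a, Uᵀ * (A * B a - B a * A) * U =
      Matrix.diagonal l * C a - C a * Matrix.diagonal l := fun a => by
    rw [← hD]
    calc Uᵀ * (A * B a - B a * A) * U
        = Uᵀ * A * 1 * B a * U - Uᵀ * B a * 1 * A * U := by
          simp only [Matrix.mul_sub, Matrix.sub_mul, Matrix.mul_assoc, Matrix.one_mul]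
      _ = _ := by simp only [← hU, hC, Matrix.mul_assoc]
  have hterm : ∀ a, max 0 (frobInner (A * B a - B a * A) (A * B a - B a * A) - 1) ≤
      ∑ i, ∑ j, max 0 ((l i - l j) ^ 2 - 1) * C a i j ^ 2 := by
    intro a
    refine max_le (Finset.sum_nonneg fun i _ => Finset.sum_nonneg fun j _ =>
      mul_nonneg (le_max_left _ _) (sq_nonneg _)) ?_
    calc frobInner (A * B a - B a * A) (A * B a - B a * A) - 1
        ≤ frobInner (A * B a - B a * A) (A * B a - B a * A) - frobInner (C a) (C a) := by
          linarith [hCle a]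
      _ = ∑ i, ∑ j, ((l i - l j) ^ 2 - 1) * C a i j ^ 2 := by
          rw [← frobInner_conj hU, hcomm]
          simp only [frobInner, Matrix.sub_apply, Matrix.diagonal_mul, Matrix.mul_diagonal,
            ← Finset.sum_sub_distrib]
          exact Finset.sum_congr rfl fun i _ => Finset.sum_congr rfl fun j _ => by ring
      _ ≤ _ := Finset.sum_le_sum fun i _ => Finset.sum_le_sum fun j _ =>
          mul_le_mul_of_nonneg_right (le_max_right _ _) (sq_nonneg _)
  calc ∑ a, max 0 (frobInner (A * B a - B a * A) (A * B a - B a * A) - 1)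
      ≤ ∑ a, ∑ i, ∑ j, max 0 ((l i - l j) ^ 2 - 1) * C a i j ^ 2 :=
        Finset.sum_le_sum fun a _ => hterm a
    _ = ∑ i, ∑ j, max 0 ((l i - l j) ^ 2 - 1) * ∑ a, C a i j ^ 2 := by
        rw [Finset.sum_comm]
        refine Finset.sum_congr rfl fun i _ => ?_
        rw [Finset.sum_comm]
        simp only [Finset.mul_sum]
    _ ≤ ∑ i, ∑ j, max 0 ((l i - l j) ^ 2 - 1) * (1 / 2) := by
        refine Finset.sum_le_sum fun i _ => Finset.sum_le_sum fun j _ => ?_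
        rcases eq_or_ne i j with rfl | hij
        · simp
        · exact mul_le_mul_of_nonneg_left (sum_sq_entry_le_half C hCsymm hCorth hCle hij)
            (le_max_left _ _)
    _ = (∑ i, ∑ j, max 0 ((l i - l j) ^ 2 - 1)) * (1 / 2) := by
        simp only [Finset.sum_mul]
    _ ≤ 1 := by linarith [sum_excess_le_two l hl]

theorem sum_frobInner_commutator_le_of_orthogonal {n p : ℕ}
    (A : Fin p → Matrix (Fin n) (Fin n) ℝ) (hsymm : ∀ r, (A r).IsSymm)
    (horth : ∀ r s, r ≠ s → frobInner (A r) (A s) = 0) :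
    ∑ r, ∑ s, frobInner (A r * A s - A s * A r) (A r * A s - A s * A r) ≤
      (∑ r, frobInner (A r) (A r)) ^ 2 := by
  set x := fun r => frobInner (A r) (A r) with hx
  have hx0 : ∀ r, 0 ≤ x r := fun r => frobInner_self_nonneg (A r)
  set Q := fun r => (√(x r))⁻¹ • A r with hQ
  have hAQ : ∀ r, A r = √(x r) • Q r := by
    intro r
    rcases (hx0 r).eq_or_lt with h0 | hpos
    · rw [eq_zero_of_frobInner_self h0.symm, ← h0]
      simp
    · rw [hQ, smul_smul, mul_inv_cancel₀ (Real.sqrt_pos.2 hpos).ne', one_smul]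
  have hQsymm : ∀ r, (Q r).IsSymm := fun r => (hsymm r).smul _
  have hQorth : ∀ r s, r ≠ s → frobInner (Q r) (Q s) = 0 := fun r s hrs => by
    simp only [hQ, frobInner_smul_smul, horth r s hrs, mul_zero]
  have hQle : ∀ r, frobInner (Q r) (Q r) ≤ 1 := fun r => by
    have h1 : frobInner (Q r) (Q r) = (x r)⁻¹ * x r := by
      simp only [hQ, frobInner_smul_smul]
      rw [← mul_inv, Real.mul_self_sqrt (hx0 r)]
    rw [h1]
    exact inv_mul_le_one
  set N := fun r s => frobInner (Q r * Q s - Q s * Q r) (Q r * Q s - Q s * Q r) with hN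
  set e := fun r s => max 0 (N r s - 1) with he
  have hrow : ∀ r, ∑ s, e r s ≤ 1 := fun r =>
    sum_commutator_excess_le_one (Q r) (hQsymm r) (hQle r) Q hQsymm hQorth hQle
  have hNsymm : ∀ r s, N r s = N s r := fun r s => by
    simp only [hN]
    rw [← neg_sub (Q s * Q r) (Q r * Q s)]
    simp only [frobInner, Matrix.neg_apply, neg_mul_neg]
  have hcol : ∀ s, ∑ r, e r s ≤ 1 := fun s => by
    simp only [he, hNsymm _ s]
    exact hrow s
  have hterm : ∀ r s, frobInner (A r * A s - A s * A r) (A r * A s - A s * A r) ≤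
      x r * x s - (if r = s then x r ^ 2 else 0)
        + (x r ^ 2 * e r s / 2 + x s ^ 2 * e r s / 2) := by
    intro r s
    have he0 : 0 ≤ e r s := le_max_left _ _
    split_ifs with hrs
    · subst hrs
      have h0 : frobInner (A r * A r - A r * A r) (A r * A r - A r * A r) = 0 := by
        simp [frobInner]
      rw [h0]
      nlinarith [mul_nonneg (sq_nonneg (x r)) he0]
    · have h1 : A r * A s - A s * A r
          = (√(x r) * √(x s)) • (Q r * Q s - Q s * Q r) := by
        conv_lhs => rw [hAQ r, hAQ s]
        simp only [smul_mul_smul_comm, smul_sub, mul_comm]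
      have h2 : √(x r) * √(x s) * (√(x r) * √(x s)) = x r * x s := by
        rw [mul_mul_mul_comm, Real.mul_self_sqrt (hx0 r), Real.mul_self_sqrt (hx0 s)]
      rw [h1, frobInner_smul_smul, h2]
      have h3 : N r s - 1 ≤ e r s := le_max_right _ _
      have h4 : x r * x s * N r s ≤ x r * x s * (1 + e r s) :=
        mul_le_mul_of_nonneg_left (by linarith) (mul_nonneg (hx0 r) (hx0 s))
      nlinarith [mul_nonneg (sq_nonneg (x r - x s)) he0]
  have hsum1 : ∑ r, ∑ s, x r ^ 2 * e r s / 2 ≤ (∑ r, x r ^ 2) / 2 := by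
    rw [Finset.sum_div]
    refine Finset.sum_le_sum fun r _ => ?_
    rw [← Finset.sum_div, ← Finset.mul_sum]
    nlinarith [mul_le_mul_of_nonneg_left (hrow r) (sq_nonneg (x r))]
  have hsum2 : ∑ r, ∑ s, x s ^ 2 * e r s / 2 ≤ (∑ r, x r ^ 2) / 2 := by
    rw [Finset.sum_comm, Finset.sum_div]
    refine Finset.sum_le_sum fun r _ => ?_
    rw [← Finset.sum_div, ← Finset.mul_sum]
    nlinarith [mul_le_mul_of_nonneg_left (hcol r) (sq_nonneg (x r))]
  have hsum3 : ∑ r, ∑ s, x r * x s = (∑ r, x r) ^ 2 := by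
    rw [pow_two, Finset.sum_mul_sum]
  refine (Finset.sum_le_sum fun r _ => Finset.sum_le_sum fun s _ => hterm r s).trans ?_
  simp only [Finset.sum_add_distrib, Finset.sum_sub_distrib, Finset.sum_ite_eq, Finset.mem_univ,
    if_true, hsum3]
  linarith

theorem sum_frobInner_rotate {n p : ℕ} {U : Matrix (Fin p) (Fin p) ℝ} (hU : U * Uᵀ = 1)
    (V : Fin p → Matrix (Fin n) (Fin n) ℝ) :
    ∑ a, frobInner (∑ r, U r a • V r) (∑ r, U r a • V r) = ∑ r, frobInner (V r) (V r) := by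
  have key : ∀ v : Fin p → ℝ,
      ∑ a, (∑ r, U r a * v r) * (∑ r, U r a * v r) = ∑ r, v r * v r := by
    intro v
    have h1 : (v ᵥ* U) ⬝ᵥ (Uᵀ *ᵥ v) = v ⬝ᵥ v := by
      rw [← Matrix.dotProduct_mulVec, Matrix.mulVec_mulVec, hU, Matrix.one_mulVec]
    simpa only [Matrix.mulVec_transpose, dotProduct, Matrix.vecMul, mul_comm] using h1
  simp only [frobInner, Matrix.sum_apply, Matrix.smul_apply, smul_eq_mul]
  rw [Finset.sum_comm, Finset.sum_comm (s := (Finset.univ : Finset (Fin p)))]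
  refine Finset.sum_congr rfl fun i _ => ?_
  rw [Finset.sum_comm, Finset.sum_comm (s := (Finset.univ : Finset (Fin p)))]
  exact Finset.sum_congr rfl fun j _ => key fun r => V r i j

/-- The DDVV inequality for symmetric matrices. -/
theorem sum_frobInner_commutator_le {n p : ℕ}
    (A : Fin p → Matrix (Fin n) (Fin n) ℝ) (hsymm : ∀ r, (A r).IsSymm) :
    ∑ r, ∑ s, frobInner (A r * A s - A s * A r) (A r * A s - A s * A r) ≤
      (∑ r, frobInner (A r) (A r)) ^ 2 := by
  have hG : (Matrix.of fun r s => frobInner (A r) (A s)).IsSymm :=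
    Matrix.IsSymm.ext fun r s => frobInner_comm _ _
  obtain ⟨U, l, hU, -, hD⟩ := exists_orthogonal_diagonalization hG
  set B := fun a => ∑ r, U r a • A r with hB
  have hBsymm : ∀ a, (B a).IsSymm := fun a => by
    simp only [hB, Matrix.IsSymm, Matrix.transpose_sum, Matrix.transpose_smul, (hsymm _).eq]
  have hBorth : ∀ a b, a ≠ b → frobInner (B a) (B b) = 0 := by
    intro a b hab
    have h1 := congrFun (congrFun hD a) b
    rw [Matrix.diagonal_apply_ne _ hab] at h1
    rw [← h1]
    simp only [hB, frobInner_eq_trace, Matrix.transpose_sum, Matrix.transpose_smul,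
      Finset.sum_mul, Finset.mul_sum, Matrix.trace_sum, Matrix.smul_mul, Matrix.mul_smul,
      Matrix.trace_smul, smul_eq_mul, Matrix.mul_apply, Matrix.transpose_apply, Matrix.of_apply]
    exact Finset.sum_congr rfl fun i _ => Finset.sum_congr rfl fun j _ => by ring
  have h1 := sum_frobInner_commutator_le_of_orthogonal B hBsymm hBorth
  rw [sum_frobInner_rotate hU] at h1
  refine le_of_eq_of_le ?_ h1
  have hl : ∀ a b, B a * B b - B b * B a = ∑ r, U r a • (A r * B b - B b * A r) := by
    intro a b
    have hBa : B a = ∑ r, U r a • A r := rfl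
    rw [hBa]
    simp only [Finset.sum_mul, Finset.mul_sum, Matrix.smul_mul, Matrix.mul_smul, smul_sub,
      Finset.sum_sub_distrib]
  have hr : ∀ r b, A r * B b - B b * A r = ∑ s, U s b • (A r * A s - A s * A r) := by
    intro r b
    simp only [hB, Finset.sum_mul, Finset.mul_sum, Matrix.smul_mul, Matrix.mul_smul, smul_sub,
      Finset.sum_sub_distrib]
  calc ∑ r, ∑ s, frobInner (A r * A s - A s * A r) (A r * A s - A s * A r)
      = ∑ r, ∑ b, frobInner (A r * B b - B b * A r) (A r * B b - B b * A r) := by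
        simp only [hr]
        exact Finset.sum_congr rfl fun r _ => (sum_frobInner_rotate hU _).symm
    _ = ∑ b, ∑ a, frobInner (B a * B b - B b * B a) (B a * B b - B b * B a) := by
        rw [Finset.sum_comm]
        simp only [hl]
        exact Finset.sum_congr rfl fun b _ => (sum_frobInner_rotate hU _).symm
    _ = _ := Finset.sum_comm

theorem two_mul_sum_lt {k : ℕ} (F : Fin k → Fin k → ℝ) (hF : ∀ i j, F i j = F j i)
    (hF0 : ∀ i, F i i = 0) :
    2 * ∑ i, ∑ j, (if i < j then F i j else 0) = ∑ i, ∑ j, F i j := by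
  have h1 : ∑ i, ∑ j, (if i < j then F i j else 0) = ∑ i, ∑ j, (if j < i then F i j else 0) := by
    rw [Finset.sum_comm]
    simp only [hF]
  rw [two_mul]
  nth_rewrite 2 [h1]
  simp only [← Finset.sum_add_distrib]
  refine Finset.sum_congr rfl fun i _ => Finset.sum_congr rfl fun j _ => ?_
  rcases lt_trichotomy i j with h | rfl | h
  · simp [h, h.not_gt]
  · simp [hF0]
  · simp [h, h.not_gt]

/-- The algebraic Wintgen inequality: the total squared length of the trace-free parts of the
shape operators dominates the length of the commutators. -/
theorem sqrt_sum_frobInner_commutator_le {n p : ℕ} (hn : n ≠ 0)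
    (A : Fin p → Matrix (Fin n) (Fin n) ℝ) (hsymm : ∀ r, (A r).IsSymm) :
    √(∑ r, ∑ s, frobInner (A r * A s - A s * A r) (A r * A s - A s * A r)) ≤
      ∑ r, (frobInner (A r) (A r) - (∑ i, A r i i) ^ 2 / n) := by
  have hnR : (n : ℝ) ≠ 0 := Nat.cast_ne_zero.2 hn
  set B := fun r => A r - ((∑ i, A r i i) / n) • (1 : Matrix (Fin n) (Fin n) ℝ) with hB
  have hBsymm : ∀ r, (B r).IsSymm := fun r =>
    (hsymm r).sub (Matrix.isSymm_one.smul _)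
  have hcomm : ∀ r s, A r * A s - A s * A r = B r * B s - B s * B r := fun r s => by
    simp only [hB, Matrix.mul_sub, Matrix.sub_mul, Matrix.smul_mul, Matrix.mul_smul,
      Matrix.one_mul, Matrix.mul_one]
    module
  have hnorm : ∀ r, frobInner (B r) (B r) = frobInner (A r) (A r) - (∑ i, A r i i) ^ 2 / n := by
    intro r
    set T := ∑ i, A r i i with hT
    have h1 : ∀ i j, B r i j * B r i j = A r i j * A r i j
        + (if i = j then (T / n) ^ 2 - 2 * (T / n) * A r i i else 0) := by
      intro i j
      simp only [hB, Matrix.sub_apply, Matrix.smul_apply, smul_eq_mul, Matrix.one_apply]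
      split_ifs with hij
      · subst hij
        ring
      · ring
    simp only [frobInner, h1, Finset.sum_add_distrib, Finset.sum_ite_eq, Finset.mem_univ, if_true,
      Finset.sum_sub_distrib, Finset.sum_const, Finset.card_univ, Fintype.card_fin,
      ← Finset.mul_sum, ← hT, nsmul_eq_mul]
    field_simp
    ring
  simp only [hcomm, ← hnorm]
  exact Real.sqrt_le_iff.2 ⟨Finset.sum_nonneg fun r _ => frobInner_self_nonneg _,
    sum_frobInner_commutator_le B hBsymm⟩

theorem rhoPerp_eq {n p : ℕ} (A : Fin p → Matrix (Fin n) (Fin n) ℝ)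
    (hsymm : ∀ r, (A r).IsSymm) (Rp : Fin n → Fin n → Fin p → Fin p → ℝ)
    (hRp : ∀ i j r s, Rp i j r s = (A r * A s - A s * A r) j i) :
    rhoPerp Rp = 1 / ((n : ℝ) * ((n : ℝ) - 1)) *
      √(∑ r, ∑ s, frobInner (A r * A s - A s * A r) (A r * A s - A s * A r)) := by
  have hrs : ∀ i j r s, Rp i j r s = - Rp i j s r := fun i j r s => by
    rw [hRp, hRp, ← Matrix.neg_apply, neg_sub]
  have hij : ∀ i j r s, Rp i j r s = - Rp j i r s := fun i j r s => by
    rw [hRp, hRp, ← Matrix.transpose_apply (A r * A s - A s * A r), ← Matrix.neg_apply]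
    simp only [Matrix.transpose_sub, Matrix.transpose_mul, (hsymm _).eq, neg_sub]
  have h1 : 4 * ∑ i, ∑ j, ∑ r, ∑ s, (if i < j ∧ r < s then Rp i j r s ^ 2 else 0)
      = ∑ r, ∑ s, frobInner (A r * A s - A s * A r) (A r * A s - A s * A r) := by
    have h2 : ∀ i j, 2 * ∑ r, ∑ s, (if r < s then Rp i j r s ^ 2 else 0)
        = ∑ r, ∑ s, Rp i j r s ^ 2 := fun i j =>
      two_mul_sum_lt (fun r s => Rp i j r s ^ 2) (fun r s => by rw [hrs i j r s, neg_sq])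
        fun r => by
          have h0 : Rp i j r r = 0 := by linarith [hrs i j r r]
          simp [h0]
    have h3 := two_mul_sum_lt (fun i j => ∑ r, ∑ s, Rp i j r s ^ 2)
      (fun i j => by simp only [hij i j, neg_sq])
      fun i => by
        have h0 : ∀ r s, Rp i i r s = 0 := fun r s => by linarith [hij i i r s]
        simp [h0]
    calc 4 * ∑ i, ∑ j, ∑ r, ∑ s, (if i < j ∧ r < s then Rp i j r s ^ 2 else 0)
        = 2 * ∑ i, ∑ j, (if i < j then
            2 * ∑ r, ∑ s, (if r < s then Rp i j r s ^ 2 else 0) else 0) := by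
          simp only [ite_and, Finset.sum_ite_irrel, Finset.sum_const_zero, ← mul_ite_zero,
            ← Finset.mul_sum]
          ring
      _ = ∑ i, ∑ j, ∑ r, ∑ s, Rp i j r s ^ 2 := by simp only [h2, h3]
      _ = ∑ j, ∑ i, ∑ r, ∑ s, Rp i j r s ^ 2 := Finset.sum_comm
      _ = ∑ x : Fin n × Fin n, ∑ y : Fin p × Fin p, Rp x.2 x.1 y.1 y.2 ^ 2 := by
          simp only [Fintype.sum_prod_type]
      _ = ∑ y : Fin p × Fin p, ∑ x : Fin n × Fin n, Rp x.2 x.1 y.1 y.2 ^ 2 := Finset.sum_comm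
      _ = _ := by simp only [Fintype.sum_prod_type, frobInner, hRp, pow_two]
  rw [rhoPerp, ← h1, Real.sqrt_mul (by norm_num), show √(4 : ℝ) = 2 by
    rw [show (4 : ℝ) = 2 ^ 2 by norm_num, Real.sqrt_sq (by norm_num)]]
  ring

/-- The scalar curvature obtained from a Gauss equation with ambient sectional curvatures
`K - q (ψᵢ² + ψⱼ²)`. -/
theorem two_mul_scalarCurv {n p : ℕ} (A : Fin p → Matrix (Fin n) (Fin n) ℝ)
    (hsymm : ∀ r, (A r).IsSymm) (R : Fin n → Fin n → Fin n → Fin n → ℝ) (K q : ℝ)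
    (ψ : Fin n → ℝ)
    (hR : ∀ i j, R i j j i = (if i = j then 0 else K - q * (ψ i ^ 2 + ψ j ^ 2))
      + ∑ r, (A r i i * A r j j - A r i j * A r j i)) :
    2 * scalarCurv R = K * (n * (n - 1)) - q * (2 * (n - 1) * ∑ i, ψ i ^ 2)
      + ∑ r, ((∑ i, A r i i) ^ 2 - frobInner (A r) (A r)) := by
  have hsum := two_mul_sum_lt (fun i j => R i j j i)
    (fun i j => by
      simp only [hR, eq_comm (a := j) (b := i), add_comm (ψ j ^ 2),
        mul_comm (A _ j j), mul_comm (A _ j i)])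
    fun i => by simp [hR]
  rw [scalarCurv, hsum]
  have h1 : ∀ i j, R i j j i = (K - q * (ψ i ^ 2 + ψ j ^ 2))
      - (if i = j then K - q * (ψ i ^ 2 + ψ i ^ 2) else 0)
      + ∑ r, (A r i i * A r j j - A r i j * A r i j) := by
    intro i j
    rw [hR]
    simp only [(hsymm _).apply i j]
    split_ifs with hij
    · subst hij
      ring
    · ring
  have h2 : ∑ i, ∑ j, ∑ r, (A r i i * A r j j - A r i j * A r i j)
      = ∑ r, ((∑ i, A r i i) ^ 2 - frobInner (A r) (A r)) := by
    simp only [Finset.sum_sub_distrib, frobInner, pow_two, Finset.sum_mul_sum]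
    congr 1
    · rw [Finset.sum_comm_cycle]
    · rw [Finset.sum_comm_cycle]
  simp only [h1, Finset.sum_add_distrib, Finset.sum_sub_distrib, ← h2]
  simp only [Finset.sum_add_distrib, Finset.sum_sub_distrib, Finset.sum_ite_eq, Finset.mem_univ,
    if_true, Finset.sum_const, Finset.card_univ, Fintype.card_fin, nsmul_eq_mul, mul_add,
    ← Finset.mul_sum]
  ring

/-- Generalized Wintgen inequality for ambient sectional curvatures `K - q (ψᵢ² + ψⱼ²)`. -/
theorem normScalarCurv_add_rhoPerp_le {n p : ℕ} (hn : 2 ≤ n)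
    (A : Fin p → Matrix (Fin n) (Fin n) ℝ)
    (hsymm : ∀ r, (A r).IsSymm) (R : Fin n → Fin n → Fin n → Fin n → ℝ) (K q : ℝ)
    (ψ : Fin n → ℝ)
    (hR : ∀ i j, R i j j i = (if i = j then 0 else K - q * (ψ i ^ 2 + ψ j ^ 2))
      + ∑ r, (A r i i * A r j j - A r i j * A r j i))
    (Rp : Fin n → Fin n → Fin p → Fin p → ℝ)
    (hRp : ∀ i j r s, Rp i j r s = (A r * A s - A s * A r) j i) :
    normScalarCurv R + rhoPerp Rp ≤ meanCurvSq A + K - 2 / n * (q * ∑ i, ψ i ^ 2) := by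
  have hn2 : (2 : ℝ) ≤ n := by exact_mod_cast hn
  have hn0 : (n : ℝ) ≠ 0 := by positivity
  have hn1 : (n : ℝ) - 1 ≠ 0 := by linarith
  have hpos : 0 < 1 / ((n : ℝ) * ((n : ℝ) - 1)) :=
    one_div_pos.2 (mul_pos (by linarith) (by linarith))
  have h1 := mul_le_mul_of_nonneg_left
    (sqrt_sum_frobInner_commutator_le (by omega) A hsymm) hpos.le
  rw [← rhoPerp_eq A hsymm Rp hRp] at h1
  have h2 : meanCurvSq A = (1 / n) ^ 2 * ∑ r, (∑ i, A r i i) ^ 2 := by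
    simp only [meanCurvSq, mul_pow, ← Finset.mul_sum]
  rw [normScalarCurv, two_mul_scalarCurv A hsymm R K q ψ hR, h2]
  refine (add_le_add_right h1 _).trans (le_of_eq ?_)
  simp only [Finset.sum_sub_distrib, ← Finset.sum_div]
  field_simp
  ring

/-- **Generalized Wintgen inequality in generalized Robertson–Walker spacetimes.**
Let `M̄^n` (`n ≥ 3`) be a submanifold of an `m`-dimensional (`m ≥ 4`) generalized
Robertson–Walker spacetime `I ×_f M^{m-1}(c)` with nowhere-vanishing smooth warping
function `f`; `Rt` is the ambient curvature at a point with `I`-coordinate `t`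
(hypothesis `warped`), `ψ` are the components of `∂/∂t` in the adapted orthonormal
frame, `gauss` is the Gauss equation and `ricci` is the Ricci equation.  If `∂/∂t` is
everywhere tangent to `M̄^n` then
`ρ + ρ^⊥ ≤ ‖H‖² + ((c - f'²)/f²)(1 - 2/n) - (2/n)(f''/f)`; if `∂/∂t` is everywhere
normal to `M̄^n` then `ρ + ρ^⊥ ≤ ‖H‖² + (c - f'²)/f²`. -/
theorem wintgen_rhoPerp_grw {n m : ℕ} (hn : 3 ≤ n) (hm : 4 ≤ m) (hnm : n ≤ m)
    (c : ℝ) (f : ℝ → ℝ) (hf : ContDiff ℝ (⊤ : ℕ∞) f) (hf0 : ∀ x, f x ≠ 0) (t : ℝ)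
    (Rt : Fin m → Fin m → Fin m → Fin m → ℝ)
    (R : Fin n → Fin n → Fin n → Fin n → ℝ)
    (h : Fin (m - n) → Matrix (Fin n) (Fin n) ℝ)
    (hsymm : ∀ r, (h r).IsSymm)
    (ψ : Fin m → ℝ) (hψ : ∑ x : Fin m, ψ x ^ 2 = 1)
    (Rperp : Fin n → Fin n → Fin (m - n) → Fin (m - n) → ℝ)
    (ricci : ∀ (i j : Fin n) (r s : Fin (m - n)),
      Rperp i j r s = (h r * h s - h s * h r) j i)
    (warped : ∀ x y z w : Fin m, Rt x y z w =
      ((c - deriv f t ^ 2) / f t ^ 2) * (kdelta y z * kdelta x w - kdelta x z * kdelta y w)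
      - (deriv (deriv f) t / f t + (c - deriv f t ^ 2) / f t ^ 2) *
          (- kdelta x z * ψ y * ψ w + kdelta y z * ψ x * ψ w
            + kdelta x w * ψ y * ψ z - kdelta y w * ψ x * ψ z))
    (gauss : ∀ i j k l : Fin n, R i j k l =
      Rt (Fin.castLE hnm i) (Fin.castLE hnm j) (Fin.castLE hnm k) (Fin.castLE hnm l)
      + ∑ r : Fin (m - n), (h r i l * h r j k - h r i k * h r j l)) :
    ((∀ x : Fin m, n ≤ (x : ℕ) → ψ x = 0) →
      normScalarCurv R + rhoPerp Rperp ≤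
        meanCurvSq h + ((c - deriv f t ^ 2) / f t ^ 2) * (1 - 2 / (n : ℝ))
          - 2 / (n : ℝ) * (deriv (deriv f) t / f t)) ∧
    ((∀ j : Fin n, ψ (Fin.castLE hnm j) = 0) →
      normScalarCurv R + rhoPerp Rperp ≤
        meanCurvSq h + (c - deriv f t ^ 2) / f t ^ 2) := by
  have hR : ∀ i j : Fin n, R i j j i =
      (if i = j then 0 else (c - deriv f t ^ 2) / f t ^ 2 -
        (deriv (deriv f) t / f t + (c - deriv f t ^ 2) / f t ^ 2) *
          (ψ (Fin.castLE hnm i) ^ 2 + ψ (Fin.castLE hnm j) ^ 2))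
      + ∑ r, (h r i i * h r j j - h r i j * h r j i) := by
    intro i j
    rw [gauss, warped]
    congr 1
    split_ifs with hij
    · subst hij
      simp only [kdelta, if_true]
      ring
    · have hne : Fin.castLE hnm i ≠ Fin.castLE hnm j := fun e => hij (Fin.castLE_injective hnm e)
      simp only [kdelta, if_true, if_neg hne, if_neg hne.symm]
      ring
  have hmain := normScalarCurv_add_rhoPerp_le (by omega) h hsymm R _ _
    (fun i => ψ (Fin.castLE hnm i)) hR Rperp ricci
  constructor
  · intro htan
    have hone : ∑ i : Fin n, ψ (Fin.castLE hnm i) ^ 2 = 1 := by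
      rw [← hψ]
      refine Fintype.sum_of_injective (Fin.castLE hnm) (Fin.castLE_injective hnm) _ _
        (fun x hx => ?_) fun i => rfl
      have hxn : n ≤ (x : ℕ) := by
        by_contra hlt
        exact hx ⟨⟨x, not_le.1 hlt⟩, rfl⟩
      simp [htan x hxn]
    rw [hone] at hmain
    linarith
  · intro hnor
    simpa [hnor] using hmain
end

section
/- Let $M^n$, $n \geq 3$, be an $n$-dimensional submanifold of an $m$-dimensional, $m \geq 4$, Riemannian manifold $(\widetilde{M}^m, \widetilde{g})$ of constant sectional curvature $c$. Then $\rho + \rho^{\perp} \leq \Vert H \Vert^2 + c$ (the generalized Wintgen / DDVV inequality), obtained from the quasi-constant curvature case by taking $q = 0$ and $p = c$. -/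
open Finset Matrix

/-- The squared Frobenius norm of a real matrix. -/
noncomputable def frobSq {κ : Type*} [Fintype κ] (X : Matrix κ κ ℝ) : ℝ :=
  ∑ i, ∑ j, X i j ^ 2

theorem frobSq_eq_trace {κ : Type*} [Fintype κ] (X : Matrix κ κ ℝ) :
    frobSq X = (Xᵀ * X).trace := by
  unfold frobSq
  rw [Finset.sum_comm]
  simp [Matrix.trace, Matrix.mul_apply, sq]

theorem frobSq_nonneg {κ : Type*} [Fintype κ] (X : Matrix κ κ ℝ) : 0 ≤ frobSq X :=
  Finset.sum_nonneg fun _ _ => Finset.sum_nonneg fun _ _ => sq_nonneg _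

/-- The Frobenius norm is invariant under orthogonal conjugation. -/
theorem frobSq_conj {κ : Type*} [Fintype κ] [DecidableEq κ] {U : Matrix κ κ ℝ}
    (hU : U * Uᵀ = 1) (X : Matrix κ κ ℝ) : frobSq (Uᵀ * X * U) = frobSq X := by
  rw [frobSq_eq_trace, frobSq_eq_trace]
  have e : (Uᵀ * X * U)ᵀ * (Uᵀ * X * U) = Uᵀ * (Xᵀ * X * U) := by
    calc (Uᵀ * X * U)ᵀ * (Uᵀ * X * U) = Uᵀ * Xᵀ * (U * Uᵀ) * X * U := by
          simp only [Matrix.transpose_mul, Matrix.transpose_transpose, Matrix.mul_assoc]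
      _ = _ := by rw [hU]; simp only [Matrix.mul_one, Matrix.mul_assoc]
  rw [e, Matrix.trace_mul_comm, Matrix.mul_assoc, hU, Matrix.mul_one]

/-- In a graph with `0/1` adjacency function `a`, the degrees of two adjacent vertices add up to
at most the number of edges plus one. -/
theorem two_mul_degree_add_degree_le {κ : Type*} [Fintype κ] [DecidableEq κ] (a : κ → κ → ℝ)
    (h0 : ∀ i j, 0 ≤ a i j) (hs : ∀ i j, a i j = a j i) (hd : ∀ i, a i i = 0)
    {i j : κ} (hij : a i j = 1) :
    2 * (∑ k, a i k + ∑ k, a j k) ≤ ∑ k, ∑ l, a k l + 2 := by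
  have hne : i ≠ j := by
    rintro rfl
    simp [hd] at hij
  let x : κ → ℝ := fun k => (if k = i then 1 else 0) + (if k = j then 1 else 0)
  have hx : ∀ k, 0 ≤ 1 - x k := by
    intro k
    by_cases h1 : k = i
    · subst h1; simp [x, hne]
    · by_cases h2 : k = j <;> simp [x, h1, h2]
      subst h2; simp [h1]
  have hpos : 0 ≤ ∑ k, ∑ l, (1 - x k) * (1 - x l) * a k l :=
    Finset.sum_nonneg fun k _ => Finset.sum_nonneg fun l _ =>
      mul_nonneg (mul_nonneg (hx k) (hx l)) (h0 k l)
  have e1 : ∑ k, ∑ l, x k * a k l = ∑ k, a i k + ∑ k, a j k := by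
    simp [x, add_mul, Finset.sum_add_distrib]
  have e2 : ∑ k, ∑ l, x l * a k l = ∑ k, a i k + ∑ k, a j k := by
    rw [Finset.sum_comm, ← e1]
    exact Finset.sum_congr rfl fun k _ => Finset.sum_congr rfl fun l _ => by rw [hs]
  have e3 : ∑ k, ∑ l, x k * (x l * a k l) = 2 := by
    have hji : a j i = 1 := by rw [hs, hij]
    simp only [x, add_mul, Finset.sum_add_distrib, mul_add, ite_mul, one_mul, zero_mul,
      Finset.sum_ite_eq', Finset.mem_univ, if_true, Finset.sum_ite_irrel, Finset.sum_const_zero]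
    rw [hij, hji, hd, hd]
    norm_num
  have e : ∑ k, ∑ l, (1 - x k) * (1 - x l) * a k l =
      ∑ k, ∑ l, a k l - ∑ k, ∑ l, x k * a k l - ∑ k, ∑ l, x l * a k l
        + ∑ k, ∑ l, x k * (x l * a k l) := by
    simp only [← Finset.sum_sub_distrib, ← Finset.sum_add_distrib]
    exact Finset.sum_congr rfl fun k _ => Finset.sum_congr rfl fun l _ => by ring
  rw [e, e1, e2, e3] at hpos
  linarith

/-- The Laplacian quadratic form of a graph with `k` edges is bounded by `k + 1`
(here every edge is counted in both orientations). -/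
theorem laplacian_form_le {κ : Type*} [Fintype κ] [DecidableEq κ] (a : κ → κ → ℝ)
    (h01 : ∀ i j, a i j = 0 ∨ a i j = 1) (hs : ∀ i j, a i j = a j i) (hd : ∀ i, a i i = 0)
    (l : κ → ℝ) :
    ∑ i, ∑ j, a i j * (l i - l j) ^ 2 ≤ (∑ i, ∑ j, a i j + 2) * ∑ i, l i ^ 2 := by
  have h0 : ∀ i j, 0 ≤ a i j := fun i j => by rcases h01 i j with h | h <;> simp [h]
  set Q := ∑ i, ∑ j, a i j * (l i - l j) ^ 2 with hQ
  set N := ∑ i, ∑ j, a i j with hN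
  set M := ∑ i, l i ^ 2 with hM
  have hN0 : 0 ≤ N := Finset.sum_nonneg fun _ _ => Finset.sum_nonneg fun _ _ => h0 _ _
  have hM0 : 0 ≤ M := Finset.sum_nonneg fun _ _ => sq_nonneg _
  let g : κ → ℝ := fun i => ∑ j, a i j * (l i - l j)
  have hQg : Q = 2 * ∑ i, l i * g i := by
    have e1 : ∑ i, l i * g i = ∑ i, ∑ j, l i * (a i j * (l i - l j)) := by
      simp only [g, Finset.mul_sum]
    have e2 : ∑ i, l i * g i = ∑ i, ∑ j, l j * (a i j * (l j - l i)) := by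
      rw [e1, Finset.sum_comm]
      exact Finset.sum_congr rfl fun k _ => Finset.sum_congr rfl fun l _ => by rw [hs]
    rw [two_mul]
    nth_rewrite 1 [e1]
    rw [e2, hQ]
    simp only [← Finset.sum_add_distrib]
    exact Finset.sum_congr rfl fun k _ => Finset.sum_congr rfl fun l _ => by ring
  have hg : ∀ i, g i ^ 2 ≤ (∑ k, a i k) * ∑ j, a i j * (l i - l j) ^ 2 := by
    intro i
    refine Finset.sum_sq_le_sum_mul_sum_of_sq_le_mul _ (fun j _ => h0 i j)
      (fun j _ => mul_nonneg (h0 i j) (sq_nonneg _)) (fun j _ => le_of_eq (by ring))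
  have hG : 4 * ∑ i, g i ^ 2 ≤ (N + 2) * Q := by
    have e1 : ∑ i, g i ^ 2 ≤ ∑ i, ∑ j, (∑ k, a i k) * (a i j * (l i - l j) ^ 2) := by
      simp only [← Finset.mul_sum]
      exact Finset.sum_le_sum fun i _ => hg i
    have e2 : ∑ i, ∑ j, (∑ k, a i k) * (a i j * (l i - l j) ^ 2) =
        ∑ i, ∑ j, (∑ k, a j k) * (a i j * (l i - l j) ^ 2) := by
      rw [Finset.sum_comm]
      refine Finset.sum_congr rfl fun i _ => Finset.sum_congr rfl fun j _ => ?_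
      rw [hs j i]; ring
    have e3 : 2 * (∑ i, ∑ j, (∑ k, a i k) * (a i j * (l i - l j) ^ 2) +
        ∑ i, ∑ j, (∑ k, a j k) * (a i j * (l i - l j) ^ 2)) ≤ (N + 2) * Q := by
      rw [hQ]
      simp only [← Finset.sum_add_distrib, Finset.mul_sum]
      refine Finset.sum_le_sum fun i _ => Finset.sum_le_sum fun j _ => ?_
      rcases h01 i j with h | h
      · simp [h]
      · have := two_mul_degree_add_degree_le a h0 hs hd h
        rw [h]
        nlinarith [mul_le_mul_of_nonneg_right this (sq_nonneg (l i - l j))]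
    linarith
  have hCS : (∑ i, l i * g i) ^ 2 ≤ M * ∑ i, g i ^ 2 :=
    Finset.sum_mul_sq_le_sq_mul_sq _ _ _
  have hQ2 : Q ^ 2 ≤ (N + 2) * M * Q := by
    rw [hQg] at hG ⊢
    nlinarith [mul_le_mul_of_nonneg_left hG hM0]
  by_contra! hc
  have hpos : 0 ≤ (N + 2) * M := by positivity
  nlinarith

/-- The total excess of the squared differences `(l i - l j) ^ 2` over `∑ i, l i ^ 2`. -/
theorem sum_excess_le {κ : Type*} [Fintype κ] [DecidableEq κ] (l : κ → ℝ) :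
    ∑ i, ∑ j, max ((l i - l j) ^ 2 - ∑ k, l k ^ 2) 0 ≤ 2 * ∑ k, l k ^ 2 := by
  set M := ∑ k, l k ^ 2 with hM
  have hM0 : 0 ≤ M := Finset.sum_nonneg fun _ _ => sq_nonneg _
  let a : κ → κ → ℝ := fun i j => if M < (l i - l j) ^ 2 then 1 else 0
  have key := laplacian_form_le a (fun i j => by by_cases h : M < (l i - l j) ^ 2 <;> simp [a, h])
    (fun i j => by simp only [a]; rw [← neg_sub, neg_sq])
    (fun i => by simp [a, hM0]) l
  have e : ∑ i, ∑ j, max ((l i - l j) ^ 2 - M) 0 =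
      ∑ i, ∑ j, a i j * (l i - l j) ^ 2 - (∑ i, ∑ j, a i j) * M := by
    simp only [Finset.sum_mul, ← Finset.sum_sub_distrib]
    refine Finset.sum_congr rfl fun i _ => Finset.sum_congr rfl fun j _ => ?_
    by_cases h : M < (l i - l j) ^ 2
    · simp [a, h, h.le]
    · simp [a, h, not_lt.mp h]
  rw [e]
  linarith

/-- The commutator bound when a combination `∑ r, u r • A r` of maximal norm is diagonal. -/
theorem sum_frobSq_comm_le_of_diagonal {ι κ : Type*} [Fintype ι] [Fintype κ] [DecidableEq κ]
    (A : ι → Matrix κ κ ℝ) (hA : ∀ r, (A r).IsSymm) (u : ι → ℝ) (hu : ∑ r, u r ^ 2 = 1)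
    (l : κ → ℝ) (hl : ∑ r, u r • A r = Matrix.diagonal l)
    (hmax : ∀ v : ι → ℝ, frobSq (∑ r, v r • A r) ≤ (∑ i, l i ^ 2) * ∑ r, v r ^ 2) :
    ∑ s, frobSq (Matrix.diagonal l * A s - A s * Matrix.diagonal l) ≤
      (∑ i, l i ^ 2) * ∑ s, frobSq (A s) := by
  set M := ∑ k, l k ^ 2 with hM
  have hM0 : 0 ≤ M := Finset.sum_nonneg fun _ _ => sq_nonneg _
  let W : κ → κ → ℝ := fun i j => ∑ s, A s i j ^ 2
  have hW0 : ∀ i j, 0 ≤ W i j := fun i j => Finset.sum_nonneg fun _ _ => sq_nonneg _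
  have hsum : ∑ s, frobSq (A s) = ∑ i, ∑ j, W i j := by
    simp only [frobSq, W]
    rw [Finset.sum_comm]
    exact Finset.sum_congr rfl fun i _ => Finset.sum_comm
  have hcomm : ∑ s, frobSq (Matrix.diagonal l * A s - A s * Matrix.diagonal l) =
      ∑ i, ∑ j, (l i - l j) ^ 2 * W i j := by
    simp only [frobSq, W, Matrix.sub_apply, Matrix.diagonal_mul, Matrix.mul_diagonal,
      Finset.mul_sum]
    rw [Finset.sum_comm]
    refine Finset.sum_congr rfl fun i _ => ?_
    rw [Finset.sum_comm]
    exact Finset.sum_congr rfl fun j _ => Finset.sum_congr rfl fun s _ => by ring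
  have hoff : ∀ i j, i ≠ j → 2 * W i j ≤ M := by
    intro i j hij
    have h1 := hmax fun s => A s i j
    have e1 : (∑ r, A r i j • A r) i j = W i j := by
      simp [Matrix.sum_apply, W, sq]
    have e2 : (∑ r, A r i j • A r) j i = W i j := by
      simp only [Matrix.sum_apply, W, sq, Matrix.smul_apply, smul_eq_mul]
      exact Finset.sum_congr rfl fun s _ => by rw [(hA s).apply]
    have h2 : 2 * W i j ^ 2 ≤ frobSq (∑ r, A r i j • A r) := by
      set X := ∑ r, A r i j • A r
      have hrow : ∀ k l, X k l ^ 2 ≤ ∑ l, X k l ^ 2 := fun k l =>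
        Finset.single_le_sum (f := fun l => X k l ^ 2) (fun _ _ => sq_nonneg _)
          (Finset.mem_univ l)
      have h3 : ∑ k ∈ {i, j}, ∑ l, X k l ^ 2 ≤ frobSq X :=
        Finset.sum_le_sum_of_subset_of_nonneg (Finset.subset_univ _)
          fun k _ _ => Finset.sum_nonneg fun _ _ => sq_nonneg _
      rw [Finset.sum_pair hij] at h3
      have h4 := hrow i j
      have h5 := hrow j i
      rw [e1] at h4
      rw [e2] at h5
      linarith
    have h3 : 2 * W i j ^ 2 ≤ M * W i j := h2.trans h1
    by_contra! hc
    nlinarith [hW0 i j]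
  have hdiag : M ≤ ∑ i, W i i := by
    refine Finset.sum_le_sum fun i _ => ?_
    have e : l i = ∑ r, u r * A r i i := by
      have := congrFun (congrFun hl i) i
      simpa [Matrix.sum_apply] using this.symm
    rw [e]
    refine (Finset.sum_mul_sq_le_sq_mul_sq _ _ _).trans ?_
    rw [hu, one_mul]
  have hterm : ∀ i j, (l i - l j) ^ 2 * W i j ≤
      M * W i j + max ((l i - l j) ^ 2 - M) 0 * (M / 2) - (if i = j then M * W i j else 0) := by
    intro i j
    by_cases hij : i = j
    · subst hij; simp [hM0]
    · have h1 := hoff i j hij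
      have h2 := le_max_left ((l i - l j) ^ 2 - M) 0
      have h3 := le_max_right ((l i - l j) ^ 2 - M) 0
      rw [if_neg hij]
      nlinarith [mul_le_mul_of_nonneg_right h2 (hW0 i j), mul_le_mul_of_nonneg_left h1 h3]
  have htot := Finset.sum_le_sum fun i (_ : i ∈ Finset.univ) =>
    Finset.sum_le_sum fun j (_ : j ∈ Finset.univ) => hterm i j
  simp only [Finset.sum_add_distrib, Finset.sum_sub_distrib, ← Finset.mul_sum, ← Finset.sum_mul,
    Finset.sum_ite_eq, Finset.mem_univ, if_true] at htot
  have hexc := sum_excess_le l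
  rw [← hM] at hexc
  rw [hcomm, hsum]
  nlinarith [mul_le_mul_of_nonneg_right hexc hM0, mul_le_mul_of_nonneg_left hdiag hM0]

/-- The commutator bound for a combination `∑ r, u r • A r` of maximal norm. -/
theorem sum_frobSq_comm_le {ι κ : Type*} [Fintype ι] [Fintype κ] [DecidableEq κ]
    (A : ι → Matrix κ κ ℝ) (hA : ∀ r, (A r).IsSymm) (u : ι → ℝ) (hu : ∑ r, u r ^ 2 = 1)
    (hmax : ∀ v : ι → ℝ,
      frobSq (∑ r, v r • A r) ≤ frobSq (∑ r, u r • A r) * ∑ r, v r ^ 2) :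
    ∑ s, frobSq ((∑ r, u r • A r) * A s - A s * (∑ r, u r • A r)) ≤
      frobSq (∑ r, u r • A r) * ∑ s, frobSq (A s) := by
  have hH : (∑ r, u r • A r).IsHermitian := by
    rw [Matrix.IsHermitian, Matrix.conjTranspose_eq_transpose_of_trivial, Matrix.transpose_sum]
    exact Finset.sum_congr rfl fun r _ => by rw [Matrix.transpose_smul, (hA r).eq]
  obtain ⟨U, hU, l, hl⟩ : ∃ U : Matrix κ κ ℝ, U * Uᵀ = 1 ∧ ∃ l : κ → ℝ,
      Uᵀ * (∑ r, u r • A r) * U = Matrix.diagonal l := by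
    refine ⟨hH.eigenvectorUnitary, ?_, hH.eigenvalues, ?_⟩
    · rw [← Matrix.conjTranspose_eq_transpose_of_trivial, ← Matrix.star_eq_conjTranspose]
      exact Unitary.coe_mul_star_self hH.eigenvectorUnitary
    · have := hH.conjStarAlgAut_star_eigenvectorUnitary
      rw [Unitary.conjStarAlgAut_star_apply, Matrix.star_eq_conjTranspose,
        Matrix.conjTranspose_eq_transpose_of_trivial] at this
      simpa using this
  let B : ι → Matrix κ κ ℝ := fun r => Uᵀ * A r * U
  have hcomb : ∀ v : ι → ℝ, ∑ r, v r • B r = Uᵀ * (∑ r, v r • A r) * U := by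
    intro v
    simp [B, Matrix.mul_sum, Matrix.sum_mul]
  have hfd : frobSq (∑ r, u r • A r) = ∑ i, l i ^ 2 := by
    rw [← frobSq_conj hU, hl, frobSq]
    refine Finset.sum_congr rfl fun i _ => ?_
    rw [Finset.sum_eq_single i] <;> simp +contextual [Matrix.diagonal, eq_comm]
  have key := sum_frobSq_comm_le_of_diagonal B
    (fun r => by simp [B, Matrix.IsSymm, Matrix.transpose_mul, (hA r).eq, Matrix.mul_assoc])
    u hu l ((hcomb u).trans hl)
    (fun v => by rw [hcomb, frobSq_conj hU, ← hfd]; exact hmax v)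
  rw [hfd]
  refine (le_of_eq ?_).trans (key.trans_eq (congrArg _ ?_))
  · refine Finset.sum_congr rfl fun s _ => ?_
    rw [← frobSq_conj hU, ← hl]
    congr 1
    have hmul : ∀ X Y : Matrix κ κ ℝ, Uᵀ * X * U * (Uᵀ * Y * U) = Uᵀ * (X * Y) * U := by
      intro X Y
      calc Uᵀ * X * U * (Uᵀ * Y * U) = Uᵀ * X * (U * Uᵀ) * Y * U := by
            simp only [Matrix.mul_assoc]
        _ = _ := by rw [hU]; simp only [Matrix.mul_one, Matrix.mul_assoc]
    simp only [B, hmul, Matrix.mul_sub, Matrix.sub_mul]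
  · exact Finset.sum_congr rfl fun s _ => frobSq_conj hU _

/-- Effect of the perturbation `1 + t u uᵀ` on the squared norm of a skew-symmetric array. -/
theorem sum_sq_skew_perturb {ι : Type*} [Fintype ι] (c : ι → ι → ℝ)
    (hc : ∀ r s, c r s = -c s r) (u : ι → ℝ) (hu : ∑ r, u r ^ 2 = 1) (t : ℝ) :
    ∑ r, ∑ s, (c r s + t * u s * (∑ k, u k * c r k) - t * u r * (∑ k, u k * c s k)) ^ 2 =
      ∑ r, ∑ s, c r s ^ 2 + (4 * t + 2 * t ^ 2) * ∑ r, (∑ k, u k * c r k) ^ 2 := by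
  set d : ι → ℝ := fun r => ∑ k, u k * c r k with hd
  change ∑ r, ∑ s, (c r s + t * u s * d r - t * u r * d s) ^ 2 =
    ∑ r, ∑ s, c r s ^ 2 + (4 * t + 2 * t ^ 2) * ∑ r, d r ^ 2
  have e1 : ∑ r, ∑ s, u s * d r * c r s = ∑ r, d r ^ 2 := by
    refine Finset.sum_congr rfl fun r _ => ?_
    rw [sq]
    nth_rewrite 3 [hd]
    simp only [Finset.mul_sum]
    exact Finset.sum_congr rfl fun s _ => by ring
  have e2 : ∑ r, ∑ s, u r * d s * c r s = -∑ r, d r ^ 2 := by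
    rw [← e1, Finset.sum_comm]
    simp only [← Finset.sum_neg_distrib]
    exact Finset.sum_congr rfl fun r _ => Finset.sum_congr rfl fun s _ => by rw [hc s r]; ring
  have e3 : ∑ r, u r * d r = 0 := by
    have h1 : ∑ r, u r * d r = ∑ r, ∑ s, u r * (u s * c r s) := by
      simp only [hd, Finset.mul_sum]
    have h2 : ∑ r, u r * d r = -∑ r, u r * d r := by
      rw [h1]
      conv_lhs => rw [Finset.sum_comm]
      simp only [← Finset.sum_neg_distrib]
      exact Finset.sum_congr rfl fun r _ => Finset.sum_congr rfl fun s _ => by rw [hc s r]; ring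
    linarith
  have e4 : ∑ r, ∑ s, u s ^ 2 * d r ^ 2 = ∑ r, d r ^ 2 := by
    simp only [← Finset.sum_mul, hu, one_mul]
  have e5 : ∑ r, ∑ s, u r ^ 2 * d s ^ 2 = ∑ r, d r ^ 2 := by
    rw [Finset.sum_comm, e4]
  have e6 : ∑ r, ∑ s, (u r * d r) * (u s * d s) = 0 := by
    simp only [← Finset.mul_sum, e3, mul_zero, Finset.sum_const_zero]
  have e : ∑ r, ∑ s, (c r s + t * u s * d r - t * u r * d s) ^ 2 =
      ∑ r, ∑ s, c r s ^ 2 + 2 * t * ∑ r, ∑ s, u s * d r * c r s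
      - 2 * t * ∑ r, ∑ s, u r * d s * c r s + t ^ 2 * ∑ r, ∑ s, u s ^ 2 * d r ^ 2
      + t ^ 2 * ∑ r, ∑ s, u r ^ 2 * d s ^ 2
      - 2 * t ^ 2 * ∑ r, ∑ s, (u r * d r) * (u s * d s) := by
    simp only [Finset.mul_sum, ← Finset.sum_sub_distrib, ← Finset.sum_add_distrib]
    exact Finset.sum_congr rfl fun r _ => Finset.sum_congr rfl fun s _ => by ring
  rw [e, e1, e2, e4, e5, e6]
  ring

theorem sum_sq_perturb {ι : Type*} [Fintype ι] (a u : ι → ℝ) (hu : ∑ r, u r ^ 2 = 1) (t : ℝ) :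
    ∑ r, (a r + t * u r * ∑ k, u k * a k) ^ 2 =
      ∑ r, a r ^ 2 + (2 * t + t ^ 2) * (∑ k, u k * a k) ^ 2 := by
  set b := ∑ k, u k * a k with hb
  have e : ∑ r, (a r + t * u r * b) ^ 2 =
      ∑ r, a r ^ 2 + 2 * t * b * ∑ k, u k * a k + t ^ 2 * b ^ 2 * ∑ r, u r ^ 2 := by
    simp only [Finset.mul_sum, ← Finset.sum_add_distrib]
    exact Finset.sum_congr rfl fun r _ => by ring
  rw [e, hu, ← hb]
  ring

theorem sum_frobSq_eq {ι κ : Type*} [Fintype ι] [Fintype κ] (A : ι → Matrix κ κ ℝ) :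
    ∑ r, frobSq (A r) = ∑ i, ∑ j, ∑ r, A r i j ^ 2 := by
  simp only [frobSq]
  rw [Finset.sum_comm]
  exact Finset.sum_congr rfl fun i _ => Finset.sum_comm

/-- The squared norm of the family of all commutators. -/
noncomputable def commSq {ι κ : Type*} [Fintype ι] [Fintype κ] (A : ι → Matrix κ κ ℝ) : ℝ :=
  ∑ r, ∑ s, frobSq (A r * A s - A s * A r)

theorem commSq_eq {ι κ : Type*} [Fintype ι] [Fintype κ] (A : ι → Matrix κ κ ℝ) :
    commSq A = ∑ i, ∑ j, ∑ r, ∑ s, (A r * A s - A s * A r) i j ^ 2 := by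
  simp only [commSq, sum_frobSq_eq]
  rw [Finset.sum_comm]
  exact Finset.sum_congr rfl fun i _ => Finset.sum_comm

theorem sum_frobSq_perturb {ι κ : Type*} [Fintype ι] [Fintype κ] (A : ι → Matrix κ κ ℝ)
    (u : ι → ℝ) (hu : ∑ r, u r ^ 2 = 1) (t : ℝ) :
    ∑ r, frobSq (A r + (t * u r) • ∑ k, u k • A k) =
      ∑ r, frobSq (A r) + (2 * t + t ^ 2) * frobSq (∑ k, u k • A k) := by
  rw [sum_frobSq_eq, sum_frobSq_eq, frobSq]
  simp only [Finset.mul_sum, ← Finset.sum_add_distrib]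
  refine Finset.sum_congr rfl fun i _ => Finset.sum_congr rfl fun j _ => ?_
  simpa [Matrix.sum_apply] using sum_sq_perturb (fun r => A r i j) u hu t

theorem commSq_perturb {ι κ : Type*} [Fintype ι] [Fintype κ] (A : ι → Matrix κ κ ℝ)
    (u : ι → ℝ) (hu : ∑ r, u r ^ 2 = 1) (t : ℝ) :
    commSq (fun r => A r + (t * u r) • ∑ k, u k • A k) =
      commSq A + (4 * t + 2 * t ^ 2) *
        ∑ s, frobSq ((∑ k, u k • A k) * A s - A s * (∑ k, u k • A k)) := by
  rw [commSq_eq, commSq_eq, sum_frobSq_eq]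
  have hd : ∀ i j r, ∑ k, u k * (A r * A k - A k * A r) i j =
      (A r * (∑ k, u k • A k) - (∑ k, u k • A k) * A r) i j := by
    intro i j r
    simp [Matrix.mul_sum, Matrix.sum_mul, Matrix.sum_apply, mul_sub]
  have key := fun i j => sum_sq_skew_perturb (fun r s => (A r * A s - A s * A r) i j)
    (fun r s => by simp) u hu t
  simp only [hd] at key
  generalize ∑ k, u k • A k = P at key ⊢
  simp only [Finset.mul_sum _ _ (4 * t + 2 * t ^ 2), ← Finset.sum_add_distrib]
  refine Finset.sum_congr rfl fun i _ => Finset.sum_congr rfl fun j _ => ?_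
  rw [Finset.sum_add_distrib, ← Finset.mul_sum]
  refine Eq.trans ?_ ((key i j).trans ?_)
  · refine Finset.sum_congr rfl fun r _ => Finset.sum_congr rfl fun s _ => ?_
    have e : (A r + (t * u r) • P) * (A s + (t * u s) • P) -
        (A s + (t * u s) • P) * (A r + (t * u r) • P) =
        (A r * A s - A s * A r) + (t * u s) • (A r * P - P * A r)
          - (t * u r) • (A s * P - P * A s) := by
      simp only [Matrix.add_mul, Matrix.mul_add, Matrix.smul_mul, Matrix.mul_smul, smul_sub,
        smul_add]
      rw [smul_comm (t * u s) (t * u r)]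
      abel
    rw [e]
    simp only [Matrix.sub_apply, Matrix.add_apply, Matrix.smul_apply, smul_eq_mul]
  · congr 2
    exact Finset.sum_congr rfl fun s _ => by simp only [Matrix.sub_apply]; ring

theorem frobSq_smul {κ : Type*} [Fintype κ] (a : ℝ) (X : Matrix κ κ ℝ) :
    frobSq (a • X) = a ^ 2 * frobSq X := by
  simp [frobSq, mul_pow, Finset.mul_sum]

theorem commSq_smul {ι κ : Type*} [Fintype ι] [Fintype κ] (a : ℝ) (A : ι → Matrix κ κ ℝ) :
    commSq (fun r => a • A r) = a ^ 4 * commSq A := by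
  simp only [commSq, Finset.mul_sum]
  refine Finset.sum_congr rfl fun r _ => Finset.sum_congr rfl fun s _ => ?_
  rw [show a • A r * a • A s - a • A s * a • A r = (a ^ 2) • (A r * A s - A s * A r) by
    simp [smul_sub, smul_smul, sq], frobSq_smul]
  ring

@[fun_prop]
theorem continuous_frobSq {κ : Type*} [Fintype κ] :
    Continuous (frobSq : Matrix κ κ ℝ → ℝ) := by
  unfold frobSq
  fun_prop

theorem continuous_commSq {ι κ : Type*} [Fintype ι] [Fintype κ] :
    Continuous (commSq : (ι → Matrix κ κ ℝ) → ℝ) := by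
  unfold commSq
  fun_prop

theorem eq_zero_of_frobSq_eq_zero {κ : Type*} [Fintype κ] {X : Matrix κ κ ℝ}
    (h : frobSq X = 0) : X = 0 := by
  rw [frobSq_eq_trace, ← Matrix.conjTranspose_eq_transpose_of_trivial] at h
  exact Matrix.trace_conjTranspose_mul_self_eq_zero_iff.mp h

theorem isCompact_unit_symm {ι κ : Type*} [Fintype ι] [Fintype κ] :
    IsCompact {A : ι → Matrix κ κ ℝ | (∀ r, (A r).IsSymm) ∧ ∑ r, frobSq (A r) = 1} := by
  have hK : IsCompact (Set.univ.pi fun _ : ι => Set.univ.pi fun _ : κ => Set.univ.pi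
      fun _ : κ => Set.Icc (-1 : ℝ) 1) :=
    isCompact_univ_pi fun _ => isCompact_univ_pi fun _ => isCompact_univ_pi fun _ => isCompact_Icc
  refine IsCompact.of_isClosed_subset hK ?_ ?_
  · rw [Set.ofPred_and]
    refine IsClosed.inter ?_ (isClosed_eq (by fun_prop) continuous_const)
    rw [Set.ofPred_forall]
    exact isClosed_iInter fun r => isClosed_eq (by fun_prop) (by fun_prop)
  · rintro A ⟨-, hA⟩ r - i - j -
    have h1 : A r i j ^ 2 ≤ 1 := by
      rw [← hA]
      calc A r i j ^ 2 ≤ ∑ j, A r i j ^ 2 :=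
            Finset.single_le_sum (f := fun j => A r i j ^ 2) (fun _ _ => sq_nonneg _)
              (Finset.mem_univ j)
        _ ≤ frobSq (A r) :=
            Finset.single_le_sum (f := fun i => ∑ j, A r i j ^ 2)
              (fun _ _ => Finset.sum_nonneg fun _ _ => sq_nonneg _) (Finset.mem_univ i)
        _ ≤ ∑ r, frobSq (A r) :=
            Finset.single_le_sum (f := fun r => frobSq (A r)) (fun _ _ => frobSq_nonneg _)
              (Finset.mem_univ r)
    exact abs_le.mp ((sq_le_one_iff_abs_le_one _).mp h1)

/-- A unit combination of maximal norm exists. -/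
theorem exists_max_combination {ι κ : Type*} [Fintype ι] [Nonempty ι] [Fintype κ]
    (A : ι → Matrix κ κ ℝ) :
    ∃ u : ι → ℝ, ∑ r, u r ^ 2 = 1 ∧ ∀ v : ι → ℝ,
      frobSq (∑ r, v r • A r) ≤ frobSq (∑ r, u r • A r) * ∑ r, v r ^ 2 := by
  classical
  have hK : IsCompact {u : ι → ℝ | ∑ r, u r ^ 2 = 1} := by
    refine IsCompact.of_isClosed_subset
      (isCompact_univ_pi fun _ : ι => isCompact_Icc (a := (-1 : ℝ)) (b := 1))
      (isClosed_eq (by fun_prop) continuous_const) ?_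
    intro u hu r _
    have h1 : u r ^ 2 ≤ 1 := by
      rw [← (show ∑ r, u r ^ 2 = 1 from hu)]
      exact Finset.single_le_sum (f := fun r => u r ^ 2) (fun _ _ => sq_nonneg _)
        (Finset.mem_univ r)
    exact abs_le.mp ((sq_le_one_iff_abs_le_one _).mp h1)
  obtain ⟨u, hu, hmax⟩ := hK.exists_isMaxOn
    ⟨Pi.single (Classical.arbitrary ι) 1, by simp [Pi.single_apply]⟩
    (f := fun v => frobSq (∑ r, v r • A r)) (by fun_prop)
  refine ⟨u, hu, fun v => ?_⟩
  have hq0 : 0 ≤ ∑ r, v r ^ 2 := Finset.sum_nonneg fun _ _ => sq_nonneg _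
  rcases hq0.eq_or_lt with hq | hq
  · have hv : ∀ r, v r = 0 := fun r => by
      have := (Finset.sum_eq_zero_iff_of_nonneg fun _ _ => sq_nonneg _).mp hq.symm r
        (Finset.mem_univ r)
      simpa using this
    simp [hv, frobSq]
  · set q := ∑ r, v r ^ 2 with hqdef
    have hs : (√q)⁻¹ ^ 2 * q = 1 := by
      rw [inv_pow, Real.sq_sqrt hq0, inv_mul_cancel₀ hq.ne']
    have h1 := hmax (show ((√q)⁻¹ • v) ∈ {u : ι → ℝ | ∑ r, u r ^ 2 = 1} by
      simp only [Set.mem_ofPred_eq, Pi.smul_apply, smul_eq_mul, mul_pow, ← Finset.mul_sum]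
      exact hs)
    simp only [Set.mem_ofPred_eq, Pi.smul_apply, smul_eq_mul, mul_smul, ← Finset.smul_sum,
      frobSq_smul] at h1
    calc frobSq (∑ r, v r • A r) = ((√q)⁻¹ ^ 2 * frobSq (∑ r, v r • A r)) * q := by
          linear_combination (-frobSq (∑ r, v r • A r)) * hs
      _ ≤ _ := mul_le_mul_of_nonneg_right h1 hq0

/-- **The DDVV inequality** for families of symmetric matrices. -/
theorem commSq_le {ι κ : Type*} [Fintype ι] [Fintype κ] (A : ι → Matrix κ κ ℝ)
    (hA : ∀ r, (A r).IsSymm) : commSq A ≤ (∑ r, frobSq (A r)) ^ 2 := by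
  classical
  have hhom : ∀ F : ℝ, (∀ B : ι → Matrix κ κ ℝ, (∀ r, (B r).IsSymm) →
      ∑ r, frobSq (B r) = 1 → commSq B ≤ F) → ∀ B : ι → Matrix κ κ ℝ,
      (∀ r, (B r).IsSymm) → commSq B ≤ F * (∑ r, frobSq (B r)) ^ 2 := by
    intro F hF B hB
    have hq0 : 0 ≤ ∑ r, frobSq (B r) := Finset.sum_nonneg fun _ _ => frobSq_nonneg _
    rcases hq0.eq_or_lt with hq | hq
    · have hz : ∀ r, B r = 0 := fun r => eq_zero_of_frobSq_eq_zero <|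
        (Finset.sum_eq_zero_iff_of_nonneg fun _ _ => frobSq_nonneg _).mp hq.symm r
          (Finset.mem_univ r)
      simp [hz, commSq, frobSq]
    · set q := ∑ r, frobSq (B r) with hqdef
      have hs : (√q)⁻¹ ^ 2 * q = 1 := by
        rw [inv_pow, Real.sq_sqrt hq0, inv_mul_cancel₀ hq.ne']
      have h1 := hF (fun r => (√q)⁻¹ • B r) (fun r => (hB r).smul _) (by
        simp only [frobSq_smul, ← Finset.mul_sum]
        exact hs)
      rw [commSq_smul] at h1
      calc commSq B = ((√q)⁻¹ ^ 4 * commSq B) * q ^ 2 := by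
            linear_combination (-commSq B * ((√q)⁻¹ ^ 2 * q + 1)) * hs
        _ ≤ _ := mul_le_mul_of_nonneg_right h1 (sq_nonneg q)
  rw [← one_mul ((∑ r, frobSq (A r)) ^ 2)]
  refine hhom 1 ?_ A hA
  intro B hB hB1
  obtain ⟨C, ⟨hC, hC1⟩, hCmax⟩ := isCompact_unit_symm.exists_isMaxOn
    ⟨B, hB, hB1⟩ continuous_commSq.continuousOn
  refine (hCmax ⟨hB, hB1⟩).trans ?_
  set F := commSq C with hFdef
  have hF0 : 0 ≤ F := Finset.sum_nonneg fun _ _ => Finset.sum_nonneg fun _ _ => frobSq_nonneg _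
  have hFmax := hhom F fun D hD hD1 => hCmax ⟨hD, hD1⟩
  have hne : Nonempty ι := by
    by_contra h
    rw [not_nonempty_iff] at h
    simp at hC1
  obtain ⟨u, hu, humax⟩ := exists_max_combination C
  have hS := sum_frobSq_comm_le C hC u hu humax
  rw [hC1, mul_one] at hS
  set P := ∑ r, u r • C r with hP
  set M := frobSq P with hMdef
  set S := ∑ s, frobSq (P * C s - C s * P) with hSdef
  have hM0 : 0 ≤ M := frobSq_nonneg _
  have hMpos : 0 < M := by
    rcases hM0.eq_or_lt with h | h
    · have hz : ∀ r, C r = 0 := fun r => by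
        have h1 := humax (Pi.single r 1)
        rw [← h, zero_mul] at h1
        have h2 := eq_zero_of_frobSq_eq_zero (le_antisymm h1 (frobSq_nonneg _))
        simpa [Pi.single_apply, ite_smul] using h2
      simp [hz, frobSq] at hC1
    · exact h
  have hPs : P.IsSymm := by
    rw [Matrix.IsSymm, hP, Matrix.transpose_sum]
    exact Finset.sum_congr rfl fun r _ => by rw [Matrix.transpose_smul, (hC r).eq]
  have hvar : ∀ t : ℝ, F + (4 * t + 2 * t ^ 2) * S ≤ F * (1 + (2 * t + t ^ 2) * M) ^ 2 := by
    intro t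
    have h1 := hFmax (fun r => C r + (t * u r) • P) fun r => (hC r).add (hPs.smul _)
    rwa [commSq_perturb C u hu t, sum_frobSq_perturb C u hu t, hC1] at h1
  have hFM : F * M ≤ S := by
    by_contra! hlt
    -- Choose `t` with `-1 < t < 0` and `2 t + t ^ 2` small against the gap `F * M - S`.
    set g := F * M - S with hg
    have hgpos : 0 < g := sub_pos.mpr hlt
    set K := F * M ^ 2 with hK
    have hK0 : 0 ≤ K := mul_nonneg hF0 (sq_nonneg _)
    obtain ⟨x, hx0, hx1, hxK⟩ : ∃ x : ℝ, 0 < x ∧ x < 1 ∧ x * K < 2 * g := by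
      refine ⟨g / (K + g + 1), by positivity, ?_, ?_⟩
      · rw [div_lt_one (by positivity)]; linarith
      · rw [div_mul_eq_mul_div, div_lt_iff₀ (by positivity)]
        nlinarith
    have h1 := hvar (√(1 - x) - 1)
    have hsq : √(1 - x) ^ 2 = 1 - x := Real.sq_sqrt (by linarith)
    rw [show 4 * (√(1 - x) - 1) + 2 * (√(1 - x) - 1) ^ 2 = -2 * x by
        linear_combination 2 * hsq,
      show 2 * (√(1 - x) - 1) + (√(1 - x) - 1) ^ 2 = -x by linear_combination hsq] at h1
    have h2 : x * (2 * g) ≤ x * (x * K) := by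
      rw [hg, hK]
      linarith
    exact absurd (le_of_mul_le_mul_left h2 hx0) (not_le.mpr hxK)
  exact le_of_mul_le_mul_right (by linarith) hMpos

/-- Subtracting a multiple of the identity does not change commutators. -/
theorem commSq_sub_smul_one {ι κ : Type*} [Fintype ι] [Fintype κ] [DecidableEq κ]
    (A : ι → Matrix κ κ ℝ) (a : ι → ℝ) :
    commSq (fun r => A r - a r • (1 : Matrix κ κ ℝ)) = commSq A := by
  unfold commSq
  refine Finset.sum_congr rfl fun r _ => Finset.sum_congr rfl fun s _ => congrArg frobSq ?_
  simp only [Matrix.sub_mul, Matrix.mul_sub, Matrix.smul_mul, Matrix.mul_smul, Matrix.one_mul,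
    Matrix.mul_one, smul_sub]
  rw [smul_comm (a r) (a s)]
  abel

/-- The squared norm of the traceless part of a matrix. -/
theorem frobSq_sub_trace {n : ℕ} (hn : (n : ℝ) ≠ 0) (X : Matrix (Fin n) (Fin n) ℝ) :
    frobSq (X - (X.trace / n) • (1 : Matrix (Fin n) (Fin n) ℝ)) =
      frobSq X - X.trace ^ 2 / n := by
  rw [frobSq_eq_trace, frobSq_eq_trace]
  simp only [Matrix.transpose_sub, Matrix.transpose_smul, Matrix.transpose_one, Matrix.sub_mul,
    Matrix.mul_sub, Matrix.smul_mul, Matrix.mul_smul, Matrix.one_mul, Matrix.mul_one,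
    Matrix.trace_sub, Matrix.trace_smul, Matrix.trace_transpose, Matrix.trace_one,
    Fintype.card_fin, smul_eq_mul]
  field_simp
  ring

theorem sum_lt_eq_half_sum {k : ℕ} (f : Fin k → Fin k → ℝ) (hs : ∀ i j, f i j = f j i)
    (hd : ∀ i, f i i = 0) :
    ∑ i, ∑ j, (if i < j then f i j else 0) = (1 / 2) * ∑ i, ∑ j, f i j := by
  have e1 : ∑ i, ∑ j, (if i < j then f i j else 0) = ∑ i, ∑ j, (if j < i then f i j else 0) := by
    rw [Finset.sum_comm]
    exact Finset.sum_congr rfl fun i _ => Finset.sum_congr rfl fun j _ => by rw [hs]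
  have e2 : ∑ i, ∑ j, f i j =
      ∑ i, ∑ j, (if i < j then f i j else 0) + ∑ i, ∑ j, (if j < i then f i j else 0) := by
    simp only [← Finset.sum_add_distrib]
    refine Finset.sum_congr rfl fun i _ => Finset.sum_congr rfl fun j _ => ?_
    rcases lt_trichotomy i j with h | h | h
    · simp [h, h.not_gt]
    · subst h; simp [hd]
    · simp [h, h.not_gt]
  rw [e2, ← e1]
  ring

/-- The scalar curvature through the Gauss equation in a space form. -/
theorem two_mul_scalarCurv_s17 {n m : ℕ} (hnm : n ≤ m) (c : ℝ)
    (Rt : Fin m → Fin m → Fin m → Fin m → ℝ) (R : Fin n → Fin n → Fin n → Fin n → ℝ)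
    (h : Fin (m - n) → Matrix (Fin n) (Fin n) ℝ) (hsymm : ∀ r, (h r).IsSymm)
    (const : ∀ x y z w : Fin m, Rt x y z w =
      c * (kdelta y z * kdelta x w - kdelta x z * kdelta y w))
    (gauss : ∀ i j k l : Fin n, R i j k l =
      Rt (Fin.castLE hnm i) (Fin.castLE hnm j) (Fin.castLE hnm k) (Fin.castLE hnm l)
      + ∑ r : Fin (m - n), (h r i l * h r j k - h r i k * h r j l)) :
    2 * scalarCurv R =
      n * (n - 1) * c + ∑ r, ((h r).trace ^ 2 - frobSq (h r)) := by
  have hR : ∀ i j, R i j j i = c * (1 - if i = j then 1 else 0) +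
      ∑ r, (h r i i * h r j j - h r i j ^ 2) := by
    intro i j
    rw [gauss, const]
    congr 1
    · by_cases hij : i = j
      · subst hij; simp [kdelta]
      · simp [kdelta, hij, Ne.symm hij]
    · exact Finset.sum_congr rfl fun r _ => by rw [(hsymm r).apply i j]; ring
  rw [scalarCurv, sum_lt_eq_half_sum (fun i j => R i j j i)]
  · simp only [hR, Finset.sum_add_distrib, ← Finset.mul_sum, Finset.sum_sub_distrib,
      Finset.sum_ite_eq, Finset.mem_univ, if_true, Finset.sum_const, Finset.card_univ,
      Fintype.card_fin, nsmul_eq_mul, mul_one]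
    have e1 : ∑ i, ∑ j, ∑ r, h r i i * h r j j = ∑ r, (h r).trace ^ 2 := by
      simp only [Matrix.trace, Matrix.diag, sq, Finset.sum_mul_sum]
      rw [Finset.sum_comm_cycle]
    have e2 : ∑ i, ∑ j, ∑ r, h r i j ^ 2 = ∑ r, frobSq (h r) := (sum_frobSq_eq h).symm
    rw [e1, e2]
    ring
  · intro i j
    simp only [hR, eq_comm (a := i) (b := j)]
    congr 1
    exact Finset.sum_congr rfl fun r _ => by rw [(hsymm r).apply i j]; ring
  · intro i
    rw [hR]
    simp [sq]

theorem sum_normal_curvature_sq {n p : ℕ} (h : Fin p → Matrix (Fin n) (Fin n) ℝ)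
    (hsymm : ∀ r, (h r).IsSymm) :
    ∑ i : Fin n, ∑ j : Fin n, ∑ r : Fin p, ∑ s : Fin p,
      (if i < j ∧ r < s then (h r * h s - h s * h r) j i ^ 2 else 0) = 1 / 4 * commSq h := by
  have hsk : ∀ r s i j, (h r * h s - h s * h r) j i = -(h r * h s - h s * h r) i j := by
    intro r s i j
    have e : (h r * h s - h s * h r)ᵀ = -(h r * h s - h s * h r) := by
      rw [Matrix.transpose_sub, Matrix.transpose_mul, Matrix.transpose_mul, (hsymm r).eq,
        (hsymm s).eq, neg_sub]
    exact congrFun (congrFun e i) j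
  have hin : ∀ i j, ∑ r : Fin p, ∑ s : Fin p,
      (if i < j ∧ r < s then (h r * h s - h s * h r) j i ^ 2 else 0) =
      if i < j then (1 / 2) * ∑ r, ∑ s, (h r * h s - h s * h r) i j ^ 2 else 0 := by
    intro i j
    by_cases hij : i < j
    · simp only [hij, true_and, if_true]
      rw [sum_lt_eq_half_sum (fun r s => (h r * h s - h s * h r) j i ^ 2)]
      · simp only [hsk _ _ i j, neg_sq]
      · intro r s
        rw [← neg_sub (h s * h r), Matrix.neg_apply, neg_sq]
      · simp
    · simp [hij]
  simp only [hin]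
  rw [sum_lt_eq_half_sum
    (fun i j => (1 / 2) * ∑ r, ∑ s, (h r * h s - h s * h r) i j ^ 2), commSq_eq]
  · simp only [← Finset.mul_sum]
    ring
  · intro i j
    simp only [hsk _ _ i j, neg_sq]
  · intro i
    have : ∀ r s, (h r * h s - h s * h r) i i = 0 := fun r s => by linarith [hsk r s i i]
    simp [this]

/-- **The generalized Wintgen (DDVV) inequality in real space forms.**
Let `M^n` (`n ≥ 3`) be a submanifold of an `m`-dimensional (`m ≥ 4`) Riemannian manifold
of constant sectional curvature `c` (hypothesis `const`), with the Gauss equation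
(`gauss`) and the Ricci equation (`ricci`).  Then `ρ + ρ^⊥ ≤ ‖H‖² + c`. -/
theorem wintgen_rhoPerp_space_form {n m : ℕ} (hn : 3 ≤ n) (hm : 4 ≤ m) (hnm : n ≤ m)
    (c : ℝ)
    (Rt : Fin m → Fin m → Fin m → Fin m → ℝ)
    (R : Fin n → Fin n → Fin n → Fin n → ℝ)
    (h : Fin (m - n) → Matrix (Fin n) (Fin n) ℝ)
    (hsymm : ∀ r, (h r).IsSymm)
    (Rperp : Fin n → Fin n → Fin (m - n) → Fin (m - n) → ℝ)
    (ricci : ∀ (i j : Fin n) (r s : Fin (m - n)),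
      Rperp i j r s = (h r * h s - h s * h r) j i)
    (const : ∀ x y z w : Fin m, Rt x y z w =
      c * (kdelta y z * kdelta x w - kdelta x z * kdelta y w))
    (gauss : ∀ i j k l : Fin n, R i j k l =
      Rt (Fin.castLE hnm i) (Fin.castLE hnm j) (Fin.castLE hnm k) (Fin.castLE hnm l)
      + ∑ r : Fin (m - n), (h r i l * h r j k - h r i k * h r j l)) :
    normScalarCurv R + rhoPerp Rperp ≤ meanCurvSq h + c := by
  have hn3 : (3 : ℝ) ≤ n := by exact_mod_cast hn
  have hn0 : (n : ℝ) ≠ 0 := by linarith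
  have hn1 : (n : ℝ) - 1 ≠ 0 := by linarith
  have hD : 0 < (n : ℝ) * (n - 1) := mul_pos (by linarith) (by linarith)
  let a : Fin (m - n) → ℝ := fun r => (h r).trace / n
  have hddvv := commSq_le (fun r => h r - a r • (1 : Matrix (Fin n) (Fin n) ℝ))
    (fun r => (hsymm r).sub (Matrix.isSymm_one.smul _))
  rw [commSq_sub_smul_one] at hddvv
  simp only [a, frobSq_sub_trace hn0] at hddvv
  have hT0 : 0 ≤ ∑ r, (frobSq (h r) - (h r).trace ^ 2 / n) :=
    Finset.sum_nonneg fun r _ => by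
      rw [← frobSq_sub_trace hn0]
      exact frobSq_nonneg _
  have hperp : rhoPerp Rperp ≤
      (∑ r, (frobSq (h r) - (h r).trace ^ 2 / n)) / (n * (n - 1)) := by
    simp only [rhoPerp, ricci]
    rw [sum_normal_curvature_sq h hsymm, div_mul_eq_mul_div]
    refine div_le_div_of_nonneg_right ?_ hD.le
    have : √(1 / 4 * commSq h) ≤ (∑ r, (frobSq (h r) - (h r).trace ^ 2 / n)) / 2 :=
      Real.sqrt_le_iff.mpr ⟨by linarith, by nlinarith⟩
    linarith
  have hmean : meanCurvSq h = (∑ r, (h r).trace ^ 2) / n ^ 2 := by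
    simp only [meanCurvSq, Matrix.trace, Matrix.diag, Finset.sum_div]
    exact Finset.sum_congr rfl fun r _ => by rw [mul_pow, one_div, inv_pow]; ring
  have hscal := two_mul_scalarCurv_s17 hnm c Rt R h hsymm const gauss
  have hfinal : normScalarCurv R +
      (∑ r, (frobSq (h r) - (h r).trace ^ 2 / n)) / (n * (n - 1)) = meanCurvSq h + c := by
    rw [normScalarCurv, hscal, hmean]
    simp only [Finset.sum_sub_distrib, ← Finset.sum_div]
    field_simp
    ring
  linarith
end
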